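/- arXiv:2307.04752 — 3 statements merged into one kernel-verified Lean document; each statement's English description precedes it below -/
import Mathlib

section
/- For each of the fifteen groups G in the list {ℤ/nℤ : 1 ≤ n ≤ 10 or n = 12} ∪ {(ℤ/2ℤ) × (ℤ/2mℤ) : 1 ≤ m ≤ 4}, the set of j-invariants j(E) ∈ ℚ of elliptic curves E defined over ℚ whose torsion subgroup of E(ℚ) is isomorphic to G is infinite; in particular, each such G occurs as the torsion subgroup of infinitely many ℚ-isomorphism classes of elliptic curves over ℚ. -/
open WeierstrassCurve

section Addition

variable {K : Type*} [Field K]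

/-- The Weierstrass curve `y² = x³ + a x² + b x + c`. -/
abbrev monicCubicCurve (a b c : K) : WeierstrassCurve K := ⟨0, a, 0, b, c⟩

theorem monicCubicCurve_equation_iff {a b c x y : K} :
    (monicCubicCurve a b c).toAffine.Equation x y ↔ y ^ 2 = x ^ 3 + a * x ^ 2 + b * x + c := by
  simp [Affine.equation_iff]

theorem monicCubicCurve_Δ (a b c : K) :
    (monicCubicCurve a b c).Δ =
      16 * (a ^ 2 * b ^ 2 - 4 * b ^ 3 - 4 * a ^ 3 * c + 18 * a * b * c - 27 * c ^ 2) := by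
  simp only [WeierstrassCurve.Δ, b₂, b₄, b₆, b₈]
  ring

theorem monicCubicCurve_c₄ (a b c : K) :
    (monicCubicCurve a b c).c₄ = 16 * (a ^ 2 - 3 * b) := by
  simp only [WeierstrassCurve.c₄, b₂, b₄]
  ring

/-- `l` is the slope of the line through `(x₁, y₁)` and `(x₂, y₂)`, tangent to the curve
`y² = x³ + a x² + b x + c` if the points agree. -/
def IsChordSlope (a b x₁ y₁ x₂ y₂ l : K) : Prop :=
  (x₁ ≠ x₂ ∧ y₁ - y₂ = l * (x₁ - x₂)) ∨
    (x₁ = x₂ ∧ y₁ = y₂ ∧ 2 * y₁ ≠ 0 ∧ l * (2 * y₁) = 3 * x₁ ^ 2 + 2 * a * x₁ + b)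

theorem add_eq_some_of_isChordSlope [DecidableEq K] {a b c x₁ y₁ x₂ y₂ l : K}
    {h₁ : (monicCubicCurve a b c).toAffine.Nonsingular x₁ y₁}
    {h₂ : (monicCubicCurve a b c).toAffine.Nonsingular x₂ y₂}
    (hl : IsChordSlope a b x₁ y₁ x₂ y₂ l) {x₃ y₃ : K}
    (hx : x₃ = l ^ 2 - a - x₁ - x₂) (hy : y₃ = -(l * (x₃ - x₁) + y₁)) :
    ∃ h₃ : (monicCubicCurve a b c).toAffine.Nonsingular x₃ y₃,
      Affine.Point.some x₁ y₁ h₁ + Affine.Point.some x₂ y₂ h₂ = Affine.Point.some x₃ y₃ h₃ := by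
  have hxy : ¬(x₁ = x₂ ∧ y₁ = (monicCubicCurve a b c).toAffine.negY x₂ y₂) := by
    rintro ⟨rfl, h⟩
    rcases hl with hl | ⟨-, rfl, h2, -⟩
    · exact hl.1 rfl
    · simp at h
      exact h2 (by linear_combination h)
  have hs : (monicCubicCurve a b c).toAffine.slope x₁ x₂ y₁ y₂ = l := by
    rcases hl with ⟨hne, hl⟩ | ⟨rfl, rfl, h2, hl⟩
    · rw [Affine.slope_of_X_ne hne, hl, mul_div_cancel_right₀ _ (sub_ne_zero.2 hne)]
    · rw [Affine.slope_of_Y_ne rfl (fun h => hxy ⟨rfl, h⟩), div_eq_iff]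
      · simp
        linear_combination -hl
      · simpa [two_mul] using h2
  have hX : (monicCubicCurve a b c).toAffine.addX x₁ x₂ l = x₃ := by
    simp [Affine.addX, hx]
  have hY : (monicCubicCurve a b c).toAffine.addY x₁ x₂ y₁ l = y₃ := by
    simp only [Affine.addY, Affine.negAddY, hX, Affine.negY, hy]
    ring
  have := Affine.Point.add_some hxy (h₁ := h₁) (h₂ := h₂)
  simp only [hs, hX, hY] at this
  exact ⟨_, this⟩

/-- Vieta's formulas for the intersection of a monic cubic curve with a line. -/
theorem IsChordSlope.vieta {a b c x₁ y₁ x₂ y₂ l : K}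
    (h₁ : y₁ ^ 2 = x₁ ^ 3 + a * x₁ ^ 2 + b * x₁ + c)
    (h₂ : y₂ ^ 2 = x₂ ^ 3 + a * x₂ ^ 2 + b * x₂ + c)
    (hl : IsChordSlope a b x₁ y₁ x₂ y₂ l) {x₃ : K} (hx : x₃ = l ^ 2 - a - x₁ - x₂) :
    x₁ * x₂ + (x₁ + x₂) * x₃ = b - 2 * l * (y₁ - l * x₁) ∧
      x₁ * x₂ * x₃ = (y₁ - l * x₁) ^ 2 - c := by
  have key : x₁ * x₂ + (x₁ + x₂) * x₃ = b - 2 * l * (y₁ - l * x₁) := by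
    subst hx
    rcases hl with ⟨hne, hl⟩ | ⟨rfl, rfl, h2, hl⟩
    · apply mul_left_cancel₀ (sub_ne_zero.2 hne)
      have : y₂ = y₁ - l * (x₁ - x₂) := by linear_combination -hl
      subst this
      linear_combination h₁ - h₂
    · linear_combination hl
  refine ⟨key, ?_⟩
  subst hx
  linear_combination x₁ * key - h₁
end Addition

section Kernel

theorem norm_mul_le_of_le_of_le {K : Type*} [NormedField K] {x y : K} {r s : ℝ}
    (hx : ‖x‖ ≤ r) (hy : ‖y‖ ≤ s) :
    ‖x * y‖ ≤ r * s := by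
  rw [norm_mul]
  exact mul_le_mul hx hy (norm_nonneg _) ((norm_nonneg _).trans hx)

variable {K : Type*} [NormedField K] [IsUltrametricDist K]

theorem norm_add_le_of_le_of_le {x y : K} {r : ℝ} (hx : ‖x‖ ≤ r) (hy : ‖y‖ ≤ r) :
    ‖x + y‖ ≤ r :=
  (IsUltrametricDist.norm_add_le_max x y).trans (max_le hx hy)

theorem norm_sub_le_of_le_of_le {x y : K} {r : ℝ} (hx : ‖x‖ ≤ r) (hy : ‖y‖ ≤ r) :
    ‖x - y‖ ≤ r := by
  rw [sub_eq_add_neg]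
  exact norm_add_le_of_le_of_le hx (by rwa [norm_neg])

theorem norm_one_add_eq_one {x : K} (hx : ‖x‖ < 1) : ‖1 + x‖ = 1 := by
  rw [IsUltrametricDist.norm_add_eq_max_of_norm_ne_norm (by simpa using hx.ne')]
  simpa using hx.le

/-- Chord and tangent addition near the point at infinity, in the coordinates
`t = x / y`, `s = 1 / y`. -/
theorem chord_estimate [CharZero K] {a b c t₁ s₁ t₂ s₂ : K} {ε : ℝ}
    (ha : ‖a‖ ≤ 1) (hb : ‖b‖ ≤ 1) (hc : ‖c‖ ≤ 1) (hε0 : 0 ≤ ε) (hε : ε < 1)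
    (hs₁ : s₁ ≠ 0) (hs₂ : s₂ ≠ 0)
    (ht₁ε : ‖t₁‖ ≤ ε) (hs₁ε : ‖s₁‖ ≤ ε ^ 3) (ht₂ε : ‖t₂‖ ≤ ε) (hs₂ε : ‖s₂‖ ≤ ε ^ 3)
    (h₁ : s₁ = t₁ ^ 3 + a * t₁ ^ 2 * s₁ + b * t₁ * s₁ ^ 2 + c * s₁ ^ 3)
    (h₂ : s₂ = t₂ ^ 3 + a * t₂ ^ 2 * s₂ + b * t₂ * s₂ ^ 2 + c * s₂ ^ 3)
    (hne : ¬(t₁ = -t₂ ∧ s₁ = -s₂)) :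
    ∃ l x₃ y₃ : K, IsChordSlope a b (t₁ / s₁) (1 / s₁) (t₂ / s₂) (1 / s₂) l ∧
      x₃ = l ^ 2 - a - t₁ / s₁ - t₂ / s₂ ∧ y₃ = -(l * (x₃ - t₁ / s₁) + 1 / s₁) ∧
      y₃ ≠ 0 ∧ ‖x₃ / y₃ - t₁ - t₂‖ ≤ ε ^ 3 ∧ ‖1 / y₃‖ ≤ ε ^ 3 := by
  have e32 : ε ^ 3 ≤ ε ^ 2 := pow_le_pow_of_le_one hε0 hε.le (by norm_num)
  have e31 : ε ^ 3 ≤ ε := by simpa using pow_le_pow_of_le_one hε0 hε.le (show 1 ≤ 3 by norm_num)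
  have e21 : ε ^ 2 ≤ ε := by simpa using pow_le_pow_of_le_one hε0 hε.le (show 1 ≤ 2 by norm_num)
  have e3 : 0 ≤ ε ^ 3 := by positivity
  have e2 : 0 ≤ ε ^ 2 := by positivity
  set U := 1 + (-(a * (t₂ * t₂)) - b * (t₂ * (s₁ + s₂)) - c * (s₁ * s₁ + s₁ * s₂ + s₂ * s₂))
    with hU
  set V := t₁ * t₁ + t₁ * t₂ + t₂ * t₂ + a * ((t₁ + t₂) * s₁) + b * (s₁ * s₁) with hV
  have hUV : (s₁ - s₂) * U = (t₁ - t₂) * V := by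
    rw [hU, hV]; linear_combination h₁ - h₂
  have mulε {x y : K} {r q : ℝ} (hx : ‖x‖ ≤ r) (hy : ‖y‖ ≤ q) (hq : q ≤ 1)  :
      ‖x * y‖ ≤ r :=
    (norm_mul_le_of_le_of_le hx hy).trans
      (mul_le_of_le_one_right ((norm_nonneg x).trans hx) hq)
  have mulε' {x y : K} {r q : ℝ} (hx : ‖x‖ ≤ r) (hy : ‖y‖ ≤ q) (hr : r ≤ 1)  :
      ‖x * y‖ ≤ q := by
    rw [mul_comm]; exact mulε hy hx hr
  have hs₁ε' := hs₁ε.trans e31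
  have hs₂ε' := hs₂ε.trans e31
  have hU1 : ‖U‖ = 1 := by
    apply norm_one_add_eq_one
    refine lt_of_le_of_lt ?_ hε
    refine norm_sub_le_of_le_of_le (norm_sub_le_of_le_of_le ?_ ?_) ?_
    · rw [norm_neg]
      exact mulε' ha (mulε ht₂ε ht₂ε hε.le) le_rfl
    · exact mulε' hb (mulε ht₂ε (norm_add_le_of_le_of_le hs₁ε' hs₂ε') hε.le) le_rfl
    · refine mulε' hc (norm_add_le_of_le_of_le (norm_add_le_of_le_of_le ?_ ?_) ?_) le_rfl
      · exact mulε hs₁ε' hs₁ε' hε.le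
      · exact mulε hs₁ε' hs₂ε' hε.le
      · exact mulε hs₂ε' hs₂ε' hε.le
  have hU0 : U ≠ 0 := fun h => by simp [h] at hU1
  have hV2 : ‖V‖ ≤ ε ^ 2 := by
    have mul2 {x y : K} (hx : ‖x‖ ≤ ε) (hy : ‖y‖ ≤ ε) : ‖x * y‖ ≤ ε ^ 2 := by
      rw [sq]; exact norm_mul_le_of_le_of_le hx hy
    refine norm_add_le_of_le_of_le (norm_add_le_of_le_of_le (norm_add_le_of_le_of_le
      (norm_add_le_of_le_of_le (mul2 ht₁ε ht₁ε) (mul2 ht₁ε ht₂ε)) (mul2 ht₂ε ht₂ε)) ?_) ?_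
    · exact mulε' ha (mul2 (norm_add_le_of_le_of_le ht₁ε ht₂ε) hs₁ε') le_rfl
    · exact mulε' hb (mul2 hs₁ε' hs₁ε') le_rfl
  obtain ⟨α, hα⟩ : ∃ α, α = V / U := ⟨_, rfl⟩
  have hα2 : ‖α‖ ≤ ε ^ 2 := by rw [hα, norm_div, hU1, div_one]; exact hV2
  have hαU : α * U = V := by rw [hα]; field_simp
  obtain ⟨β, hβ⟩ : ∃ β, β = s₁ - α * t₁ := ⟨_, rfl⟩
  have hβ3 : ‖β‖ ≤ ε ^ 3 := by
    rw [hβ]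
    refine norm_sub_le_of_le_of_le hs₁ε ?_
    exact (norm_mul_le_of_le_of_le hα2 ht₁ε).trans (by rw [pow_succ ε 2])
  have hβ' : β = s₂ - α * t₂ := by
    apply mul_right_cancel₀ hU0
    rw [hβ]
    linear_combination hUV + (t₂ - t₁) * hαU
  set W := 1 + (a * α + b * (α * α) + c * (α * (α * α))) with hW
  have hα1 := hα2.trans e21
  have hW1 : ‖W‖ = 1 := by
    apply norm_one_add_eq_one
    refine lt_of_le_of_lt ?_ hε
    refine norm_add_le_of_le_of_le (norm_add_le_of_le_of_le ?_ ?_) ?_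
    · exact mulε' ha hα1 le_rfl
    · exact mulε' hb (mulε hα1 hα1 hε.le) le_rfl
    · exact mulε' hc (mulε hα1 (mulε hα1 hα1 hε.le) hε.le) le_rfl
  have hW0 : W ≠ 0 := fun h => by simp [h] at hW1
  have htangent (ht : t₁ = t₂) (hs : s₁ = s₂) : β * U = -2 * s₁ := by
    rw [hβ]
    subst ht hs
    linear_combination (-t₁) * hαU + s₁ * hU - t₁ * hV + 3 * h₁
  have hβ0 : β ≠ 0 := by
    intro h0
    have hα0 : α ≠ 0 := by
      rintro rfl
      apply hs₁
      linear_combination h0 - hβ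
    have hx : t₁ / s₁ = t₂ / s₂ := by
      rw [div_eq_div_iff hs₁ hs₂]
      apply mul_left_cancel₀ hα0
      linear_combination (hβ - h0) * s₂ - (hβ' - h0) * s₁
    obtain ⟨x, hx1⟩ : ∃ x, x = t₁ / s₁ := ⟨_, rfl⟩
    have ht1 : t₁ = x * s₁ := by rw [hx1]; field_simp
    have ht2 : t₂ = x * s₂ := by rw [hx1, hx]; field_simp
    have hq : s₁ ^ 2 = s₂ ^ 2 := by
      have q1 : 1 = s₁ ^ 2 * (x ^ 3 + a * x ^ 2 + b * x + c) := by
        apply mul_left_cancel₀ hs₁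
        rw [ht1] at h₁
        linear_combination h₁
      have q2 : 1 = s₂ ^ 2 * (x ^ 3 + a * x ^ 2 + b * x + c) := by
        apply mul_left_cancel₀ hs₂
        rw [ht2] at h₂
        linear_combination h₂
      have : x ^ 3 + a * x ^ 2 + b * x + c ≠ 0 := by
        intro h; rw [h] at q1; simp at q1
      apply mul_right_cancel₀ this
      rw [← q1, ← q2]
    rcases sq_eq_sq_iff_eq_or_eq_neg.1 hq with h | h
    · have := htangent (by rw [ht1, ht2, h]) h
      rw [h0] at this
      simp [hs₁] at this
    · exact hne ⟨by rw [ht1, ht2, h]; ring, h⟩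
  obtain ⟨l, hl⟩ : ∃ l, l = -α / β := ⟨_, rfl⟩
  have hlβ : l * β = -α := by rw [hl]; field_simp
  have hy₁ : 1 / s₁ ^ 2 = (t₁ / s₁) ^ 3 + a * (t₁ / s₁) ^ 2 + b * (t₁ / s₁) + c := by
    field_simp
    linear_combination h₁
  have hy₂ : 1 / s₂ ^ 2 = (t₂ / s₂) ^ 3 + a * (t₂ / s₂) ^ 2 + b * (t₂ / s₂) + c := by
    field_simp
    linear_combination h₂
  have hslope : IsChordSlope a b (t₁ / s₁) (1 / s₁) (t₂ / s₂) (1 / s₂) l := by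
    by_cases hx : t₁ / s₁ = t₂ / s₂
    · right
      obtain ⟨x, hx1⟩ : ∃ x, x = t₁ / s₁ := ⟨_, rfl⟩
      have ht1 : t₁ = x * s₁ := by rw [hx1]; field_simp
      have ht2 : t₂ = x * s₂ := by rw [hx1, hx]; field_simp
      have hs : s₁ = s₂ := by
        have q1 : β = s₁ * (1 - α * x) := by rw [hβ, ht1]; ring
        have q2 : β = s₂ * (1 - α * x) := by rw [hβ', ht2]; ring
        have : 1 - α * x ≠ 0 := by
          intro h; rw [h] at q1; simp at q1; exact hβ0 q1
        apply mul_right_cancel₀ this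
        rw [← q1, ← q2]
      have ht : t₁ = t₂ := by rw [ht1, ht2, hs]
      refine ⟨hx, by rw [hs], by simpa using hs₁, ?_⟩
      have := htangent ht hs
      have h2 : l * (2 * s₁) = V := by
        rw [← hαU]
        linear_combination l * this - U * hlβ
      subst ht hs
      field_simp
      rw [mul_assoc, mul_comm l]
      linear_combination h2 + hV
    · left
      refine ⟨hx, ?_⟩
      apply mul_left_cancel₀ hβ0
      have q1 : β * (1 / s₁) = 1 - α * (t₁ / s₁) := by rw [hβ]; field_simp
      have q2 : β * (1 / s₂) = 1 - α * (t₂ / s₂) := by rw [hβ']; field_simp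
      rw [mul_sub, q1, q2]
      linear_combination -(t₁ / s₁ - t₂ / s₂) * hlβ
  obtain ⟨x₃, hx₃⟩ : ∃ x₃, x₃ = l ^ 2 - a - t₁ / s₁ - t₂ / s₂ := ⟨_, rfl⟩
  obtain ⟨v2, v3⟩ := hslope.vieta (by simpa using hy₁) (by simpa using hy₂) hx₃
  obtain ⟨x₁, hx₁⟩ : ∃ x, x = t₁ / s₁ := ⟨_, rfl⟩
  obtain ⟨x₂, hx₂⟩ : ∃ x, x = t₂ / s₂ := ⟨_, rfl⟩
  obtain ⟨y₁, hy₁'⟩ : ∃ x, x = 1 / s₁ := ⟨_, rfl⟩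
  obtain ⟨y₂, hy₂'⟩ : ∃ x, x = 1 / s₂ := ⟨_, rfl⟩
  obtain ⟨y₃, hy₃⟩ : ∃ y₃, y₃ = -(l * (x₃ - t₁ / s₁) + 1 / s₁) := ⟨_, rfl⟩
  refine ⟨l, x₃, y₃, hslope, hx₃, hy₃, ?_⟩
  have l1 : β * y₁ = 1 - α * x₁ := by rw [hβ, hx₁, hy₁']; field_simp
  have l2 : β * y₂ = 1 - α * x₂ := by rw [hβ', hx₂, hy₂']; field_simp
  rw [← hx₁, ← hy₁'] at hy₃ v2 v3
  rw [← hx₁, ← hx₂] at hx₃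
  rw [← hx₂] at v2 v3
  have l3 : β * (-y₃) = 1 - α * x₃ := by
    rw [hy₃]; linear_combination (x₃ - x₁) * hlβ + l1
  have hνβ : (y₁ - l * x₁) * β = 1 := by linear_combination l1 - x₁ * hlβ
  set ν := y₁ - l * x₁ with hν
  -- symmetric functions of the `xᵢ`, scaled by powers of `β`
  have w1 : β ^ 2 * (x₁ + x₂ + x₃) = α ^ 2 - a * β ^ 2 := by
    linear_combination β ^ 2 * hx₃ + (l * β - α) * hlβ
  have w2 : β ^ 2 * (x₁ * x₂ + (x₁ + x₂) * x₃) = b * β ^ 2 + 2 * α := by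
    linear_combination β ^ 2 * v2 - 2 * l * β * hνβ - 2 * hlβ
  have w3 : β ^ 2 * (x₁ * x₂ * x₃) = 1 - c * β ^ 2 := by
    linear_combination β ^ 2 * v3 + (ν * β + 1) * hνβ
  have prod : (β * y₁) * (β * y₂) * (β * (-y₃)) = W := by
    have hβ2 : β ^ 2 ≠ 0 := pow_ne_zero _ hβ0
    apply mul_left_cancel₀ hβ2
    rw [l1, l2, l3, hW]
    linear_combination (-α) * w1 + α ^ 2 * w2 - α ^ 3 * w3
  have hy₃0 : y₃ ≠ 0 := by
    rintro rfl
    apply hW0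
    rw [← prod]; ring
  have hy₁0 : y₁ ≠ 0 := by rw [hy₁']; simpa using hs₁
  have hy₂0 : y₂ ≠ 0 := by rw [hy₂']; simpa using hs₂
  have ht₁y : t₁ = x₁ / y₁ := by rw [hx₁, hy₁']; field_simp
  have ht₂y : t₂ = x₂ / y₂ := by rw [hx₂, hy₂']; field_simp
  have sum : (x₃ / y₃ - t₁ - t₂) * W = β * (a + 2 * b * α + 3 * c * (α * α)) := by
    have : (x₃ / y₃ - t₁ - t₂) * W =
        -β * (x₁ * (β * y₂) * (β * (-y₃)) + x₂ * (β * y₁) * (β * (-y₃)) +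
          x₃ * (β * y₁) * (β * y₂)) := by
      rw [← prod, ht₁y, ht₂y]
      field_simp
      ring
    rw [this, l1, l2, l3]
    have hβ2 : β ^ 2 ≠ 0 := pow_ne_zero _ hβ0
    apply mul_left_cancel₀ hβ2
    linear_combination -β * w1 + 2 * α * β * w2 - 3 * α ^ 2 * β * w3
  have hsum : ‖x₃ / y₃ - t₁ - t₂‖ ≤ ε ^ 3 := by
    have : ‖(x₃ / y₃ - t₁ - t₂) * W‖ ≤ ε ^ 3 := by
      rw [sum]
      have n2 : ‖(2 : K)‖ ≤ 1 := by exact_mod_cast IsUltrametricDist.norm_natCast_le_one K 2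
      have n3 : ‖(3 : K)‖ ≤ 1 := by exact_mod_cast IsUltrametricDist.norm_natCast_le_one K 3
      have hα1' := hα1.trans hε.le
      refine mulε hβ3 (norm_add_le_of_le_of_le (norm_add_le_of_le_of_le ha ?_) ?_) le_rfl
      · exact mulε (mulε n2 hb le_rfl) hα1' le_rfl
      · exact mulε (mulε n3 hc le_rfl) (mulε hα1' hα1' le_rfl) le_rfl
    rwa [norm_mul, hW1, mul_one] at this
  refine ⟨hy₃0, hsum, ?_⟩
  have ht₃ : ‖x₃ / y₃‖ ≤ ε := by
    have : x₃ / y₃ = (x₃ / y₃ - t₁ - t₂) + t₁ + t₂ := by ring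
    rw [this]
    exact norm_add_le_of_le_of_le (norm_add_le_of_le_of_le (hsum.trans e31) ht₁ε) ht₂ε
  have : 1 / y₃ = α * (x₃ / y₃) - β := by
    field_simp
    linear_combination -l3
  rw [this]
  refine norm_sub_le_of_le_of_le ?_ hβ3
  exact (norm_mul_le_of_le_of_le hα2 ht₃).trans (by rw [pow_succ ε 2])

end Kernel

section Torsion

open Affine.Point

variable {K : Type*} [NormedField K]

/-- The points of a Weierstrass curve whose coordinates `(x / y, 1 / y)` at infinity are bounded
by `(ε, ε ^ 3)`. -/
def InKernel {W : WeierstrassCurve K} (ε : ℝ) (P : W.toAffine.Point) : Prop :=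
  P = 0 ∨ ∃ x y h, P = some x y h ∧ y ≠ 0 ∧ ‖x / y‖ ≤ ε ∧ ‖1 / y‖ ≤ ε ^ 3

/-- The local parameter `x / y` at infinity. -/
def localParam {W : WeierstrassCurve K} : W.toAffine.Point → K
  | zero => 0
  | .some x y _ => x / y

@[simp]
theorem localParam_zero {W : WeierstrassCurve K} : localParam (0 : W.toAffine.Point) = 0 := rfl

@[simp]
theorem localParam_some {W : WeierstrassCurve K} {x y : K} (h : W.toAffine.Nonsingular x y) :
    localParam (some x y h) = x / y := rfl

theorem InKernel.add [IsUltrametricDist K] [CharZero K] [DecidableEq K] {a b c : K} {ε : ℝ}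
    (ha : ‖a‖ ≤ 1) (hb : ‖b‖ ≤ 1) (hc : ‖c‖ ≤ 1) (hε0 : 0 ≤ ε) (hε : ε < 1)
    {P Q : (monicCubicCurve a b c).toAffine.Point} (hP : InKernel ε P) (hQ : InKernel ε Q) :
    InKernel ε (P + Q) ∧ ‖localParam (P + Q) - localParam P - localParam Q‖ ≤ ε ^ 3 := by
  have e3 : 0 ≤ ε ^ 3 := by positivity
  rcases hP with rfl | ⟨x₁, y₁, h₁, rfl, hy₁, ht₁, hs₁⟩
  · simpa [e3] using hQ
  rcases hQ with rfl | ⟨x₂, y₂, h₂, rfl, hy₂, ht₂, hs₂⟩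
  · rw [add_zero]
    exact ⟨Or.inr ⟨x₁, y₁, h₁, rfl, hy₁, ht₁, hs₁⟩, by simpa using e3⟩
  by_cases hxy : x₁ = x₂ ∧ y₁ = -y₂
  · obtain ⟨rfl, rfl⟩ := hxy
    rw [add_of_Y_eq rfl (by simp)]
    refine ⟨Or.inl rfl, ?_⟩
    rw [localParam_zero, localParam_some, localParam_some]
    rw [div_neg]
    simpa using e3
  have chart {x y : K} (hy : y ≠ 0) (h : (monicCubicCurve a b c).toAffine.Nonsingular x y) :
      1 / y = (x / y) ^ 3 + a * (x / y) ^ 2 * (1 / y) + b * (x / y) * (1 / y) ^ 2 +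
        c * (1 / y) ^ 3 := by
    have := monicCubicCurve_equation_iff.1 h.1
    field_simp
    linear_combination this
  obtain ⟨l, x₃, y₃, hl, hx, hy, hy0, hsum, hs⟩ := chord_estimate ha hb hc hε0 hε
    (one_div_ne_zero hy₁) (one_div_ne_zero hy₂) ht₁ hs₁ ht₂ hs₂ (chart hy₁ h₁) (chart hy₂ h₂)
    (by
      rintro ⟨h, h'⟩
      have hy : y₁ = -y₂ := by
        field_simp at h'
        linear_combination h'
      refine hxy ⟨?_, hy⟩
      rw [hy] at h
      field_simp at h
      exact neg_injective h)
  have q {x y : K} (hy : y ≠ 0) : x / y / (1 / y) = x := by field_simp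
  rw [q hy₁, q hy₂, one_div_one_div, one_div_one_div] at hl
  rw [q hy₁, q hy₂] at hx
  rw [q hy₁, one_div_one_div] at hy
  obtain ⟨h₃, hadd⟩ := add_eq_some_of_isChordSlope hl hx hy (h₁ := h₁) (h₂ := h₂)
  rw [hadd]
  refine ⟨Or.inr ⟨x₃, y₃, h₃, rfl, hy0, ?_, hs⟩, hsum⟩
  have : x₃ / y₃ = (x₃ / y₃ - x₁ / y₁ - x₂ / y₂) + x₁ / y₁ + x₂ / y₂ := by ring
  rw [this]
  exact norm_add_le_of_le_of_le (norm_add_le_of_le_of_le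
    (hsum.trans (by simpa using pow_le_pow_of_le_one hε0 hε.le (show 1 ≤ 3 by norm_num))) ht₁) ht₂

theorem InKernel.nsmul [IsUltrametricDist K] [CharZero K] [DecidableEq K] {a b c : K} {ε : ℝ}
    (ha : ‖a‖ ≤ 1) (hb : ‖b‖ ≤ 1) (hc : ‖c‖ ≤ 1) (hε0 : 0 ≤ ε) (hε : ε < 1)
    {P : (monicCubicCurve a b c).toAffine.Point} (hP : InKernel ε P) (n : ℕ) :
    InKernel ε (n • P) ∧ ‖localParam (n • P) - n * localParam P‖ ≤ ε ^ 3 := by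
  induction n with
  | zero => simpa using ⟨Or.inl rfl, by positivity⟩
  | succ n ih =>
    obtain ⟨h₁, h₂⟩ := ih.1.add ha hb hc hε0 hε hP
    rw [succ_nsmul]
    refine ⟨h₁, ?_⟩
    have := norm_add_le_of_le_of_le h₂ ih.2
    refine le_of_eq_of_le ?_ this
    congr 1
    push_cast
    ring

/-- A nonzero point in the kernel lies in the smallest kernel allowed by its parameter. -/
theorem InKernel.refine [IsUltrametricDist K] {a b c : K} {ε : ℝ}
    (ha : ‖a‖ ≤ 1) (hb : ‖b‖ ≤ 1) (hc : ‖c‖ ≤ 1) (hε : ε < 1)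
    {P : (monicCubicCurve a b c).toAffine.Point} (hP : InKernel ε P) (hP0 : P ≠ 0) :
    0 < ‖localParam P‖ ∧ ‖localParam P‖ ≤ ε ∧ InKernel ‖localParam P‖ P := by
  rcases hP with rfl | ⟨x, y, h, rfl, hy, ht, hs⟩
  · exact absurd rfl hP0
  have hε0 : 0 ≤ ε := (norm_nonneg _).trans ht
  rw [localParam_some]
  have key : ‖1 / y‖ = ‖x / y‖ ^ 3 := by
    have heq : (1 / y) * (1 + (-(a * (x / y) * (x / y)) - b * (x / y) * (1 / y) -
        c * (1 / y) * (1 / y))) = (x / y) ^ 3 := by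
      have := monicCubicCurve_equation_iff.1 h.1
      field_simp
      linear_combination this
    rw [← norm_pow, ← heq, norm_mul, norm_one_add_eq_one, mul_one]
    have hs' : ‖1 / y‖ ≤ ε :=
      hs.trans (by simpa using pow_le_pow_of_le_one hε0 hε.le (show 1 ≤ 3 by norm_num))
    have m {d u v : K} (hd : ‖d‖ ≤ 1) (hu : ‖u‖ ≤ ε) (hv : ‖v‖ ≤ ε) : ‖d * u * v‖ ≤ ε :=
      (norm_mul_le_of_le_of_le (norm_mul_le_of_le_of_le hd hu) hv).trans (by nlinarith)
    exact (norm_sub_le_of_le_of_le (norm_sub_le_of_le_of_le (by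
      rw [norm_neg]; exact m ha ht ht) (m hb ht hs')) (m hc hs' hs')).trans_lt hε
  refine ⟨?_, ht, Or.inr ⟨x, y, h, rfl, hy, le_rfl, key.le⟩⟩
  by_contra! h0
  have h0 : ‖x / y‖ = 0 := le_antisymm h0 (norm_nonneg _)
  rw [h0] at key
  simp [hy] at key

/-- Torsion points of a Weierstrass curve with `p`-integral coefficients and `a₁ = a₃ = 0` have
`p`-integral `x`-coordinate. -/
theorem norm_le_one_of_isOfFinAddOrder {p : ℕ} [Fact p.Prime] {a b c : ℚ_[p]}
    (ha : ‖a‖ ≤ 1) (hb : ‖b‖ ≤ 1) (hc : ‖c‖ ≤ 1) [DecidableEq ℚ_[p]] {x y : ℚ_[p]}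
    {h : (monicCubicCurve a b c).toAffine.Nonsingular x y}
    (ht : IsOfFinAddOrder (some x y h)) : ‖x‖ ≤ 1 := by
  by_contra! hx
  have hp : p.Prime := Fact.out
  have heq := monicCubicCurve_equation_iff.1 h.1
  have hx0 : x ≠ 0 := by rintro rfl; simp at hx; linarith
  have hxi : ‖x⁻¹‖ < 1 := by rw [norm_inv]; exact inv_lt_one_of_one_lt₀ hx
  have hyx : ‖y‖ ^ 2 = ‖x‖ ^ 3 := by
    have : y ^ 2 = x ^ 3 * (1 + (a * x⁻¹ + b * (x⁻¹ * x⁻¹) + c * (x⁻¹ * (x⁻¹ * x⁻¹)))) := by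
      rw [heq]; field_simp; ring
    rw [← norm_pow, this, norm_mul, norm_one_add_eq_one, mul_one, norm_pow]
    refine lt_of_le_of_lt ?_ hxi
    have m {u v : ℚ_[p]} {r : ℝ} (hu : ‖u‖ ≤ 1) (hv : ‖v‖ ≤ r) : ‖u * v‖ ≤ r :=
      (norm_mul_le_of_le_of_le hu hv).trans (by simp)
    exact norm_add_le_of_le_of_le (norm_add_le_of_le_of_le (m ha le_rfl)
      (m hb (m hxi.le le_rfl))) (m hc (m hxi.le (m hxi.le le_rfl)))
  have hy0 : y ≠ 0 := by
    rintro rfl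
    have : 0 < ‖x‖ ^ 3 := by positivity
    simp at hyx
    exact hx0 (by simpa using hyx.symm)
  have hny : 0 < ‖y‖ := norm_pos_iff.2 hy0
  have hnx : 0 < ‖x‖ := norm_pos_iff.2 hx0
  have hsq : ‖x / y‖ ^ 2 = ‖x‖⁻¹ := by
    rw [norm_div, div_pow, hyx]; field_simp
  have hε : ‖x / y‖ < 1 := by
    have : ‖x / y‖ ^ 2 < 1 := by rw [hsq]; exact inv_lt_one_of_one_lt₀ hx
    exact (sq_lt_one_iff₀ (norm_nonneg _)).1 this
  have hker : InKernel ‖x / y‖ (some x y h) := by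
    refine Or.inr ⟨x, y, h, rfl, hy0, le_rfl, le_of_eq ?_⟩
    rw [norm_div, norm_div, div_pow, ← hyx, norm_one]
    field_simp
  -- pass to a point of exact order `p`
  have hpos := ht.addOrderOf_pos
  set N := addOrderOf (some x y h) with hN
  have tpos : 0 < ‖x / y‖ := by rw [norm_div]; positivity
  have hpN : p ∣ N := by
    have := (hker.nsmul ha hb hc (norm_nonneg _) hε N).2
    rw [hN, addOrderOf_nsmul_eq_zero, ← hN] at this
    simp only [localParam_zero, localParam_some, zero_sub, norm_neg, norm_mul] at this
    have h2 : ‖(N : ℚ_[p])‖ < 1 := by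
      have : ‖(N : ℚ_[p])‖ ≤ ‖x / y‖ ^ 2 := by
        have e : ‖x / y‖ ^ 3 = ‖x / y‖ ^ 2 * ‖x / y‖ := by ring
        rw [e, norm_div] at this
        rw [norm_div]
        exact le_of_mul_le_mul_right this (by positivity)
      exact this.trans_lt (by rw [hsq]; exact inv_lt_one_of_one_lt₀ hx)
    exact (Padic.norm_natCast_lt_one_iff).1 h2
  obtain ⟨M, hM⟩ := hpN
  obtain ⟨hQ, -⟩ := hker.nsmul ha hb hc (norm_nonneg _) hε M
  have hM0 : 0 < M := by
    rcases Nat.eq_zero_or_pos M with h | h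
    · simp [h] at hM; omega
    · exact h
  have hQ0 : M • some x y h ≠ 0 := by
    intro h0
    have := Nat.le_of_dvd hM0 (addOrderOf_dvd_of_nsmul_eq_zero h0)
    rw [← hN, hM] at this
    have := hp.two_le
    nlinarith
  have hpQ : p • M • some x y h = 0 := by
    rw [← mul_nsmul, mul_comm, ← hM, hN, addOrderOf_nsmul_eq_zero]
  obtain ⟨q0, qle, qker⟩ := hQ.refine ha hb hc hε hQ0
  set τ := ‖localParam (M • some x y h)‖ with hτ
  have hτ1 : τ < 1 := qle.trans_lt hε
  have := (qker.nsmul ha hb hc q0.le hτ1 p).2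
  rw [hpQ] at this
  simp only [localParam_zero, zero_sub, norm_neg, norm_mul, ← hτ, Padic.norm_p] at this
  have hτp : τ ≤ (p : ℝ)⁻¹ := by
    have := (Padic.norm_le_pow_iff_norm_lt_pow_add_one
      (localParam (M • some x y h)) (-1)).2 (by simpa using hτ1)
    simpa using this
  have hp1 : (p : ℝ)⁻¹ < 1 := inv_lt_one_of_one_lt₀ (by exact_mod_cast hp.one_lt)
  have : (p : ℝ)⁻¹ ≤ τ ^ 2 := by
    have e : τ ^ 3 = τ ^ 2 * τ := by ring
    rw [e] at this
    exact le_of_mul_le_mul_right this q0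
  nlinarith

end Torsion

section Reduction

open Affine.Point

theorem norm_le_one_of_isOfFinAddOrder_rat {p : ℕ} [Fact p.Prime] {A B C : ℤ} {x y : ℚ}
    {h : (monicCubicCurve (A : ℚ) B C).toAffine.Nonsingular x y}
    (ht : IsOfFinAddOrder (some x y h)) : ‖(x : ℚ_[p])‖ ≤ 1 := by
  classical
  have transfer {W : WeierstrassCurve ℚ_[p]} (hW : W = monicCubicCurve (A : ℚ_[p]) B C)
      {u v : ℚ_[p]} {h : W.toAffine.Nonsingular u v} (ht : IsOfFinAddOrder (some u v h)) :
      ‖u‖ ≤ 1 := by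
    subst hW
    exact norm_le_one_of_isOfFinAddOrder (Padic.norm_int_le_one A) (Padic.norm_int_le_one B)
      (Padic.norm_int_le_one C) ht
  let f : (monicCubicCurve (A : ℚ) B C).toAffine.Point →+
      ((monicCubicCurve (A : ℚ) B C)⁄ℚ_[p]).toAffine.Point :=
    map (W' := monicCubicCurve (A : ℚ) B C) (Algebra.ofId ℚ ℚ_[p])
  have hf := f.isOfFinAddOrder ht
  have hW : (monicCubicCurve (A : ℚ) B C)⁄ℚ_[p] = monicCubicCurve (A : ℚ_[p]) B C := by
    simp [WeierstrassCurve.baseChange, WeierstrassCurve.map]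
  exact transfer hW (h := ((monicCubicCurve (A : ℚ) B C).toAffine.baseChange_nonsingular
    (Algebra.ofId ℚ ℚ_[p]).injective x y).2 h) hf

theorem norm_sub_eq_of_norm_lt {K : Type*} [NormedField K] [IsUltrametricDist K] {x y : K}
    (h : ‖y‖ < ‖x‖) : ‖x - y‖ = ‖x‖ := by
  rw [sub_eq_add_neg, IsUltrametricDist.norm_add_eq_max_of_norm_ne_norm
    (by rw [norm_neg]; exact h.ne'), norm_neg]
  exact max_eq_left h.le

/-- Two `p`-integral points of a curve with good reduction at `p` whose reductions agree are equal
as soon as the `x`-coordinate of their difference, if it is defined, is `p`-integral. -/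
theorem eq_of_norm_sub_lt_one {p : ℕ} [Fact p.Prime] {A B C : ℤ} (h2 : ‖(2 : ℚ_[p])‖ = 1)
    {x₁ y₁ x₂ y₂ : ℚ}
    {h₁ : (monicCubicCurve (A : ℚ) B C).toAffine.Nonsingular x₁ y₁}
    {h₂ : (monicCubicCurve (A : ℚ) B C).toAffine.Nonsingular x₂ y₂}
    (hx₁ : ‖(x₁ : ℚ_[p])‖ ≤ 1) (hx₂ : ‖(x₂ : ℚ_[p])‖ ≤ 1)
    (hx : ‖(x₁ : ℚ_[p]) - x₂‖ < 1) (hy : ‖(y₁ : ℚ_[p]) - y₂‖ < 1)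
    (hy₁ : ‖(y₁ : ℚ_[p])‖ ≤ 1)
    (hns : ‖(y₁ : ℚ_[p])‖ < 1 → ‖3 * (x₁ : ℚ_[p]) ^ 2 + 2 * A * x₁ + B‖ = 1)
    (hsub : ∀ x y h, some x₁ y₁ h₁ - some x₂ y₂ h₂ = some x y h → ‖(x : ℚ_[p])‖ ≤ 1) :
    x₁ = x₂ ∧ y₁ = y₂ := by
  by_contra hne
  have e₁ := monicCubicCurve_equation_iff.1 h₁.1
  have e₂ := monicCubicCurve_equation_iff.1 h₂.1
  have h₂' : (monicCubicCurve (A : ℚ) B C).toAffine.Nonsingular x₂ (-y₂) := by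
    simpa using ((monicCubicCurve (A : ℚ) B C).toAffine.nonsingular_neg x₂ y₂).2 h₂
  have hsub' : some x₁ y₁ h₁ - some x₂ y₂ h₂ = some x₁ y₁ h₁ + some x₂ (-y₂) h₂' := by
    rw [sub_eq_add_neg, neg_some]
    simp
  suffices h : ∃ l : ℚ, IsChordSlope (A : ℚ) B x₁ y₁ x₂ (-y₂) l ∧ 1 < ‖(l : ℚ_[p])‖ by
    obtain ⟨l, hl, hl1⟩ := h
    obtain ⟨h₃, hadd⟩ := add_eq_some_of_isChordSlope (h₁ := h₁) (h₂ := h₂') hl rfl rfl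
    have hle := hsub _ _ _ (hsub'.trans hadd)
    push_cast at hle
    have hA := Padic.norm_int_le_one (p := p) A
    have : ‖(l : ℚ_[p]) ^ 2‖ ≤ 1 := by
      have e : (l : ℚ_[p]) ^ 2 = (l ^ 2 - A - x₁ - x₂) + A + x₁ + x₂ := by ring
      rw [e]
      exact norm_add_le_of_le_of_le (norm_add_le_of_le_of_le (norm_add_le_of_le_of_le hle hA) hx₁)
        hx₂
    rw [norm_pow] at this
    nlinarith
  have large {u v l : ℚ_[p]} (hu : ‖u‖ = 1) (hv : ‖v‖ < 1) (h : l * v = u) : 1 < ‖l‖ := by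
    have : ‖l‖ * ‖v‖ = 1 := by rw [← norm_mul, h, hu]
    nlinarith [norm_nonneg v, norm_nonneg l]
  have cast_eq {u v : ℚ} (h : u = v) : (u : ℚ_[p]) = v := by rw [h]
  by_cases hxx : x₁ = x₂
  · subst hxx
    have hyy : y₁ = -y₂ := by
      have : (y₁ - y₂) * (y₁ + y₂) = 0 := by linear_combination e₁ - e₂
      rcases mul_eq_zero.1 this with h | h
      · exact absurd ⟨rfl, sub_eq_zero.1 h⟩ hne
      · linear_combination h
    have hy0 : y₁ ≠ 0 := by
      intro h
      exact hne ⟨rfl, by linear_combination 2 * h - hyy⟩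
    have hy2 : ‖2 * (y₁ : ℚ_[p])‖ < 1 := by
      refine lt_of_eq_of_lt ?_ hy
      rw [hyy]
      push_cast
      congr 1
      ring
    have hy1 : ‖(y₁ : ℚ_[p])‖ < 1 := by rwa [norm_mul, h2, one_mul] at hy2
    refine ⟨(3 * x₁ ^ 2 + 2 * A * x₁ + B) / (2 * y₁), Or.inr ⟨rfl, hyy, by simpa, ?_⟩, ?_⟩
    · field_simp
    · refine large (hns hy1) hy2 ?_
      have : (y₁ : ℚ_[p]) ≠ 0 := by exact_mod_cast hy0
      push_cast
      field_simp
  · have hxx' : x₁ - x₂ ≠ 0 := sub_ne_zero.2 hxx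
    refine ⟨(y₁ + y₂) / (x₁ - x₂), Or.inl ⟨hxx, by field_simp; ring⟩, ?_⟩
    obtain ⟨l, hl⟩ : ∃ l, l = (y₁ + y₂) / (x₁ - x₂) := ⟨_, rfl⟩
    rw [← hl]
    have hl' : l * (x₁ - x₂) = y₁ + y₂ := by rw [hl]; field_simp
    rcases hy₁.lt_or_eq with hlt | heq
    · have hmul : l * (y₁ - y₂) = x₁ ^ 2 + x₁ * x₂ + x₂ ^ 2 + A * (x₁ + x₂) + B := by
        apply mul_right_cancel₀ hxx'
        linear_combination (y₁ - y₂) * hl' + e₁ - e₂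
      have hmul' := cast_eq hmul
      push_cast at hmul'
      refine large ?_ hy hmul'
      have hA := Padic.norm_int_le_one (p := p) A
      have n1 := norm_add_le_of_le_of_le (norm_add_le_of_le_of_le (norm_add_le_of_le_of_le hx₁ hx₁)
        hx₂) hA
      have n2 : ‖((x₁ : ℚ_[p]) + x₁ + x₂ + A) * (x₁ - x₂)‖ < 1 := by
        rw [norm_mul]
        exact lt_of_le_of_lt (mul_le_of_le_one_left (norm_nonneg _) n1) hx
      have hu := hns hlt
      rw [← hu, ← norm_sub_eq_of_norm_lt (n2.trans_eq hu.symm)]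
      congr 1
      ring
    · have hl'' := cast_eq hl'
      push_cast at hl''
      refine large ?_ hx hl''
      have e : (y₁ : ℚ_[p]) + y₂ = 2 * y₁ - (y₁ - y₂) := by ring
      have h2y : ‖2 * (y₁ : ℚ_[p])‖ = 1 := by rw [norm_mul, h2, heq, one_mul]
      rw [e, norm_sub_eq_of_norm_lt (hy.trans_eq h2y.symm), h2y]

open Classical in
/-- Reduction modulo `p` of a `p`-integral rational number (and zero for the others). -/
noncomputable def redMod (p : ℕ) [Fact p.Prime] (z : ℚ) : ZMod p :=
  if h : ∃ u : ℤ_[p], (u : ℚ_[p]) = z then PadicInt.toZMod h.choose else 0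

theorem redMod_eq {p : ℕ} [Fact p.Prime] {z : ℚ} {u : ℤ_[p]} (h : (u : ℚ_[p]) = z) :
    redMod p z = PadicInt.toZMod u := by
  have h' : ∃ u : ℤ_[p], (u : ℚ_[p]) = z := ⟨u, h⟩
  rw [redMod, dif_pos h', PadicInt.ext (h'.choose_spec.trans h.symm)]

theorem PadicInt.toZMod_eq_zero_iff {p : ℕ} [Fact p.Prime] {u : ℤ_[p]} :
    PadicInt.toZMod u = 0 ↔ ‖u‖ < 1 := by
  rw [← RingHom.mem_ker, PadicInt.ker_toZMod, IsLocalRing.mem_maximalIdeal, PadicInt.mem_nonunits]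

theorem norm_sub_lt_one_of_redMod_eq {p : ℕ} [Fact p.Prime] {z w : ℚ}
    (hz : ‖(z : ℚ_[p])‖ ≤ 1) (hw : ‖(w : ℚ_[p])‖ ≤ 1) (h : redMod p z = redMod p w) :
    ‖(z : ℚ_[p]) - w‖ < 1 := by
  obtain ⟨u, hu⟩ : ∃ u : ℤ_[p], (u : ℚ_[p]) = z := ⟨⟨z, hz⟩, rfl⟩
  obtain ⟨v, hv⟩ : ∃ v : ℤ_[p], (v : ℚ_[p]) = w := ⟨⟨w, hw⟩, rfl⟩
  rw [redMod_eq hu, redMod_eq hv, ← sub_eq_zero, ← map_sub, PadicInt.toZMod_eq_zero_iff] at h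
  rw [← hu, ← hv]
  exact_mod_cast h

/-- The reduction of a torsion point modulo `p`, with `none` as the point at infinity. -/
noncomputable def reducePoint (p : ℕ) [Fact p.Prime] {W : WeierstrassCurve ℚ} :
    W.toAffine.Point → Option (ZMod p × ZMod p)
  | zero => none
  | .some x y _ => .some (redMod p x, redMod p y)

/-- The affine points of `y² = x³ + a x² + b x + c` over `ZMod p`. -/
def affinePoints (p : ℕ) [NeZero p] (a b c : ZMod p) : Finset (ZMod p × ZMod p) :=
  Finset.univ.filter fun P => P.2 ^ 2 = P.1 ^ 3 + a * P.1 ^ 2 + b * P.1 + c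

theorem card_torsion_le {p : ℕ} [Fact p.Prime] {A B C : ℤ} (hp : p ≠ 2)
    (hns : ∀ P ∈ affinePoints p A B C, P.2 = 0 →
      3 * P.1 ^ 2 + 2 * (A : ZMod p) * P.1 + (B : ZMod p) ≠ 0) :
    Finite (AddCommGroup.torsion (monicCubicCurve (A : ℚ) B C).toAffine.Point) ∧
    Nat.card (AddCommGroup.torsion (monicCubicCurve (A : ℚ) B C).toAffine.Point) ≤
      (affinePoints p A B C).card + 1 := by
  have h2 : ‖(2 : ℚ_[p])‖ = 1 := by
    have := (Padic.norm_natCast_eq_one_iff (p := p) (n := 2)).2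
      ((Nat.coprime_primes Fact.out Nat.prime_two).2 hp)
    exact_mod_cast this
  have hy {x y : ℚ} (h : (monicCubicCurve (A : ℚ) B C).toAffine.Nonsingular x y)
      (hx : ‖(x : ℚ_[p])‖ ≤ 1) : ‖(y : ℚ_[p])‖ ≤ 1 := by
    have e := monicCubicCurve_equation_iff.1 h.1
    have e' : (y : ℚ_[p]) ^ 2 = x ^ 3 + A * x ^ 2 + B * x + C := by exact_mod_cast e
    have key : ‖(y : ℚ_[p]) ^ 2‖ ≤ 1 := by
      obtain ⟨u, hu⟩ : ∃ u : ℤ_[p], (u : ℚ_[p]) = x := ⟨⟨x, hx⟩, rfl⟩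
      rw [e', ← hu]
      have := PadicInt.norm_le_one (u ^ 3 + (A : ℤ_[p]) * u ^ 2 + (B : ℤ_[p]) * u + (C : ℤ_[p]))
      rw [PadicInt.norm_def] at this
      push_cast at this
      exact this
    rw [norm_pow] at key
    exact (sq_le_one_iff₀ (norm_nonneg _)).1 key
  have hmem {x y : ℚ} (h : (monicCubicCurve (A : ℚ) B C).toAffine.Nonsingular x y)
      (hx : ‖(x : ℚ_[p])‖ ≤ 1) : (redMod p x, redMod p y) ∈ affinePoints p A B C := by
    have e := monicCubicCurve_equation_iff.1 h.1
    have e' : (y : ℚ_[p]) ^ 2 = x ^ 3 + A * x ^ 2 + B * x + C := by exact_mod_cast e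
    obtain ⟨u, hu⟩ : ∃ u : ℤ_[p], (u : ℚ_[p]) = x := ⟨⟨x, hx⟩, rfl⟩
    obtain ⟨v, hv⟩ : ∃ v : ℤ_[p], (v : ℚ_[p]) = y := ⟨⟨y, hy h hx⟩, rfl⟩
    rw [← hu, ← hv] at e'
    have e'' : v ^ 2 = u ^ 3 + A * u ^ 2 + B * u + C := by
      apply PadicInt.ext
      exact_mod_cast e'
    have := congrArg PadicInt.toZMod e''
    simp only [map_add, map_mul, map_pow, map_intCast] at this
    simpa only [affinePoints, Finset.mem_filter, Finset.mem_univ, true_and, redMod_eq hu,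
      redMod_eq hv] using this
  have hnorm {x y : ℚ} {h : (monicCubicCurve (A : ℚ) B C).toAffine.Nonsingular x y}
      (ht : some x y h ∈ AddCommGroup.torsion (monicCubicCurve (A : ℚ) B C).toAffine.Point) :
      ‖(x : ℚ_[p])‖ ≤ 1 := norm_le_one_of_isOfFinAddOrder_rat ht
  let f : AddCommGroup.torsion (monicCubicCurve (A : ℚ) B C).toAffine.Point →
      (affinePoints p A B C).insertNone := fun P => ⟨reducePoint p P.1, by
    obtain ⟨_ | ⟨x, y, h⟩, hP⟩ := P
    · exact Finset.none_mem_insertNone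
    · exact Finset.some_mem_insertNone.2 (hmem h (hnorm hP))⟩
  have hf : Function.Injective f := by
    rintro ⟨_ | ⟨x₁, y₁, h₁⟩, hP⟩ ⟨_ | ⟨x₂, y₂, h₂⟩, hQ⟩ h
    · rfl
    · simp [f, reducePoint] at h
    · simp [f, reducePoint] at h
    · simp only [f, reducePoint, Subtype.mk.injEq, Option.some.injEq, Prod.mk.injEq] at h
      have hx₁ := hnorm hP
      have hx₂ := hnorm hQ
      have := eq_of_norm_sub_lt_one h2 hx₁ hx₂ (norm_sub_lt_one_of_redMod_eq hx₁ hx₂ h.1)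
        (norm_sub_lt_one_of_redMod_eq (hy h₁ hx₁) (hy h₂ hx₂) h.2) (hy h₁ hx₁) (h₁ := h₁)
        (h₂ := h₂) ?_ ?_
      · obtain ⟨rfl, rfl⟩ := this
        rfl
      · intro hlt
        obtain ⟨u, hu⟩ : ∃ u : ℤ_[p], (u : ℚ_[p]) = x₁ := ⟨⟨x₁, hx₁⟩, rfl⟩
        obtain ⟨v, hv⟩ : ∃ v : ℤ_[p], (v : ℚ_[p]) = y₁ := ⟨⟨y₁, hy h₁ hx₁⟩, rfl⟩
        have h0 : redMod p y₁ = 0 := by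
          rw [redMod_eq hv, PadicInt.toZMod_eq_zero_iff]
          rw [← hv] at hlt
          exact_mod_cast hlt
        have hne := hns _ (hmem h₁ hx₁) h0
        by_contra h1
        apply hne
        rw [← hu] at h1
        have hlt1 : ‖3 * u ^ 2 + 2 * A * u + B‖ < 1 :=
          lt_of_le_of_ne (PadicInt.norm_le_one _) (by exact_mod_cast h1)
        have := PadicInt.toZMod_eq_zero_iff.2 hlt1
        simpa only [redMod_eq hu, map_add, map_mul, map_pow, map_intCast, map_ofNat] using this
      · intro x y h hsub
        have := (AddCommGroup.torsion (monicCubicCurve (A : ℚ) B C).toAffine.Point).sub_mem hP hQ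
        rw [hsub] at this
        exact hnorm this
  refine ⟨Finite.of_injective f hf, (Nat.card_le_card_of_injective f hf).trans ?_⟩
  rw [Nat.card_eq_fintype_card, Fintype.card_coe, Finset.card_insertNone]

/-- The torsion subgroup is determined by a subgroup as large as the reduction modulo `p`. -/
theorem nonempty_torsion_addEquiv {p : ℕ} [Fact p.Prime] {A B C : ℤ} (hp : p ≠ 2)
    (hns : ∀ P ∈ affinePoints p A B C, P.2 = 0 →
      3 * P.1 ^ 2 + 2 * (A : ZMod p) * P.1 + (B : ZMod p) ≠ 0)
    {G : Type*} [AddCommGroup G] [Finite G] (hG : (affinePoints p A B C).card + 1 ≤ Nat.card G)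
    (f : G →+ (monicCubicCurve (A : ℚ) B C).toAffine.Point) (hf : Function.Injective f) :
    Nonempty (AddCommGroup.torsion (monicCubicCurve (A : ℚ) B C).toAffine.Point ≃+ G) := by
  obtain ⟨hfin, hcard⟩ := card_torsion_le hp hns
  let g : G →+ AddCommGroup.torsion (monicCubicCurve (A : ℚ) B C).toAffine.Point :=
    f.codRestrict _ fun x => f.isOfFinAddOrder (isOfFinAddOrder_of_finite x)
  have hg : Function.Injective g := fun x y h => hf (congrArg Subtype.val h)
  exact ⟨(AddEquiv.ofBijective g (hg.bijective_of_nat_card_le (hcard.trans hG))).symm⟩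

end Reduction

section Orders

variable {A : Type*} [AddCommGroup A]

theorem addOrderOf_eq_of_nsmul_ne_zero {P : A} {n a b : ℕ} (hn : n • P = 0) (ha : a • P ≠ 0)
    (hb : b • P ≠ 0) (h : ∀ d ≤ n, d ∣ n → ¬ d ∣ a → ¬ d ∣ b → d = n) (hpos : 0 < n) :
    addOrderOf P = n := by
  have hd := addOrderOf_dvd_of_nsmul_eq_zero hn
  exact h _ (Nat.le_of_dvd hpos hd) hd (fun h' => ha (addOrderOf_dvd_iff_nsmul_eq_zero.1 h'))
    (fun h' => hb (addOrderOf_dvd_iff_nsmul_eq_zero.1 h'))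

theorem exists_injective_zmod {P : A} {n : ℕ} (hP : addOrderOf P = n) :
    ∃ f : ZMod n →+ A, Function.Injective f ∧ f 1 = P := by
  refine ⟨ZMod.lift n ⟨zmultiplesHom A P, ?_⟩, (ZMod.lift_injective _).2 ?_, ?_⟩
  · simpa using addOrderOf_dvd_iff_nsmul_eq_zero.1 hP.dvd
  · intro m hm
    rw [ZMod.intCast_zmod_eq_zero_iff_dvd, ← hP]
    exact addOrderOf_dvd_iff_zsmul_eq_zero.2 (by simpa using hm)
  · simpa using ZMod.lift_coe n ⟨zmultiplesHom A P, _⟩ 1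

theorem exists_injective_zmod_two_prod {P T : A} {m : ℕ} (hm : 0 < m)
    (hP : addOrderOf P = 2 * m) (hT : 2 • T = 0) (hT0 : T ≠ 0) (hTm : T ≠ m • P) :
    ∃ f : ZMod 2 × ZMod (2 * m) →+ A, Function.Injective f := by
  obtain ⟨f, hf, hf1⟩ := exists_injective_zmod hP
  obtain ⟨g, hg, hg1⟩ := exists_injective_zmod (addOrderOf_eq_prime hT hT0)
  refine ⟨g.coprod f, (injective_iff_map_eq_zero _).2 ?_⟩
  rintro ⟨x, y⟩ h
  rw [AddMonoidHom.coprod_apply] at h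
  have : NeZero (2 * m) := ⟨by positivity⟩
  obtain ⟨k, rfl⟩ := ZMod.natCast_zmod_surjective y
  have hk : f k = k • P := by rw [← hf1, ← map_nsmul, nsmul_one]
  obtain rfl | rfl : x = 0 ∨ x = 1 :=
    (by decide : ∀ x : ZMod 2, x = 0 ∨ x = 1) x
  · rw [map_zero, zero_add] at h
    exact Prod.ext rfl ((injective_iff_map_eq_zero f).1 hf _ h)
  · exfalso
    rw [hg1, hk] at h
    have h2 : (2 * k) • P = 0 := by
      have := congrArg (2 • ·) h
      simpa only [nsmul_add, hT, zero_add, nsmul_zero, ← mul_nsmul'] using this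
    have hmk : m ∣ k := by
      rw [← addOrderOf_dvd_iff_nsmul_eq_zero, hP] at h2
      exact Nat.dvd_of_mul_dvd_mul_left two_pos h2
    obtain ⟨j, rfl⟩ := hmk
    have hmP : 2 • m • P = 0 := by
      rw [← mul_nsmul', ← addOrderOf_dvd_iff_nsmul_eq_zero, hP]
    rw [mul_nsmul] at h
    obtain ⟨i, rfl⟩ | ⟨i, rfl⟩ := Nat.even_or_odd j
    · rw [← two_mul, mul_nsmul, hmP, nsmul_zero, add_zero] at h
      exact hT0 h
    · rw [add_nsmul, mul_nsmul, hmP, nsmul_zero, zero_add, one_nsmul] at h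
      apply hTm
      rw [eq_neg_of_add_eq_zero_left h, neg_eq_iff_add_eq_zero, ← two_nsmul, hmP]

end Orders

section IntegralPoints

variable {a b c : ℤ}

/-- `P` is the affine point of `y² = x³ + a x² + b x + c` with integral coordinates `(x, y)`. -/
def HasCoords (P : (monicCubicCurve (a : ℚ) b c).toAffine.Point) (x y : ℤ) : Prop :=
  ∃ h, P = .some (x : ℚ) (y : ℚ) h

variable {P : (monicCubicCurve (a : ℚ) b c).toAffine.Point} {x₁ y₁ x₂ y₂ : ℤ} {k m n : ℕ}

theorem exists_hasCoords (hE : (monicCubicCurve (a : ℚ) b c).IsElliptic) (x y : ℤ)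
    (h : y ^ 2 = x ^ 3 + a * x ^ 2 + b * x + c) :
    ∃ P : (monicCubicCurve (a : ℚ) b c).toAffine.Point, HasCoords (1 • P) x y := by
  have h' : (monicCubicCurve (a : ℚ) b c).toAffine.Equation x y :=
    monicCubicCurve_equation_iff.2 (by exact_mod_cast h)
  exact ⟨.some _ _ ((monicCubicCurve (a : ℚ) b c).toAffine.equation_iff_nonsingular.1 h'), _,
    one_nsmul _⟩

theorem HasCoords.ne_zero (h : HasCoords P x₁ y₁) : P ≠ 0 := by
  obtain ⟨h, rfl⟩ := h
  exact Affine.Point.some_ne_zero h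

theorem HasCoords.ne {Q : (monicCubicCurve (a : ℚ) b c).toAffine.Point} (h : HasCoords P x₁ y₁)
    (hQ : HasCoords Q x₂ y₂) (hx : x₁ ≠ x₂) : P ≠ Q := by
  obtain ⟨h, rfl⟩ := h
  obtain ⟨h', rfl⟩ := hQ
  intro e
  injection e with e
  exact hx (by exact_mod_cast e)

/-- Addition of two multiples of `P` with different `x`-coordinates; `l` is the slope of the
chord. -/
theorem HasCoords.add (l x₃ y₃ : ℤ) (h₁ : HasCoords (m • P) x₁ y₁) (h₂ : HasCoords (n • P) x₂ y₂)
    (hne : x₁ ≠ x₂) (hl : y₁ - y₂ = l * (x₁ - x₂)) (hx : x₃ = l ^ 2 - a - x₁ - x₂)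
    (hy : y₃ = -(l * (x₃ - x₁) + y₁)) (hk : m + n = k) : HasCoords (k • P) x₃ y₃ := by
  obtain ⟨h₁, e₁⟩ := h₁
  obtain ⟨h₂, e₂⟩ := h₂
  obtain ⟨h₃, e₃⟩ := add_eq_some_of_isChordSlope (a := (a : ℚ)) (b := b) (c := c) (h₁ := h₁)
    (h₂ := h₂) (l := (l : ℚ)) (x₃ := (x₃ : ℚ)) (y₃ := (y₃ : ℚ))
    (Or.inl ⟨by exact_mod_cast hne, by exact_mod_cast hl⟩) (by exact_mod_cast hx)
    (by exact_mod_cast hy)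
  exact ⟨h₃, by rw [← hk, add_nsmul, e₁, e₂, e₃]⟩

/-- Duplication of a multiple of `P`; `l` is the slope of the tangent. -/
theorem HasCoords.double (l x₃ y₃ : ℤ) (h₁ : HasCoords (m • P) x₁ y₁) (hne : y₁ ≠ 0)
    (hl : l * (2 * y₁) = 3 * x₁ ^ 2 + 2 * a * x₁ + b) (hx : x₃ = l ^ 2 - a - x₁ - x₁)
    (hy : y₃ = -(l * (x₃ - x₁) + y₁)) (hk : m + m = k) : HasCoords (k • P) x₃ y₃ := by
  obtain ⟨h₁, e₁⟩ := h₁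
  obtain ⟨h₃, e₃⟩ := add_eq_some_of_isChordSlope (a := (a : ℚ)) (b := b) (c := c) (h₁ := h₁)
    (h₂ := h₁) (l := (l : ℚ)) (x₃ := (x₃ : ℚ)) (y₃ := (y₃ : ℚ))
    (Or.inr ⟨rfl, rfl, by simpa using hne, by exact_mod_cast hl⟩) (by exact_mod_cast hx)
    (by exact_mod_cast hy)
  exact ⟨h₃, by rw [← hk, add_nsmul, e₁, e₃]⟩

theorem HasCoords.add_nsmul_eq_zero (h₁ : HasCoords (m • P) x₁ y₁)
    (h₂ : HasCoords (n • P) x₁ y₂) (hy : y₁ = -y₂) (hk : m + n = k) : k • P = 0 := by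
  obtain ⟨h₁, e₁⟩ := h₁
  obtain ⟨h₂, e₂⟩ := h₂
  rw [← hk, add_nsmul, e₁, e₂]
  exact Affine.Point.add_of_Y_eq rfl (by simp [hy])

end IntegralPoints

theorem Int.ne_of_cast_zmod_ne (p : ℕ) {x y : ℤ} (h : (x : ZMod p) ≠ y) : x ≠ y :=
  fun e => h (congrArg _ e)

section Families

open Polynomial

theorem infinite_image_eval_pow_div_eval {U D : ℤ[X]} {e : ℤ} (hD : D.eval e = 0)
    (hU : U.eval e ≠ 0) {S : Set ℤ} (hS : S.Infinite) (hSD : ∀ t ∈ S, D.eval t ≠ 0) (n : ℕ) :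
    ((fun t : ℤ => ((U.eval t : ℤ) : ℚ) ^ n / ((D.eval t : ℤ) : ℚ)) '' S).Infinite := by
  intro hfin
  refine hS (Set.Finite.of_finite_fibers _ hfin fun j _ => ?_)
  let F : ℚ[X] := U.map (Int.castRingHom ℚ) ^ n - Polynomial.C j * D.map (Int.castRingHom ℚ)
  have hF (t : ℤ) : F.eval (t : ℚ) = ((U.eval t : ℤ) : ℚ) ^ n - j * ((D.eval t : ℤ) : ℚ) := by
    simp [F]
  have hF0 : F ≠ 0 := by
    intro h
    have := hF e
    rw [h, hD, eval_zero, Int.cast_zero, mul_zero, sub_zero] at this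
    exact pow_ne_zero n (Int.cast_ne_zero.2 hU) this.symm
  refine Set.Finite.subset ((F.rootSet_finite ℚ).preimage Int.cast_injective.injOn) ?_
  rintro t ⟨ht, rfl⟩
  have hDt : ((D.eval t : ℤ) : ℚ) ≠ 0 := by exact_mod_cast hSD t ht
  rw [Set.mem_preimage, mem_rootSet]
  refine ⟨hF0, ?_⟩
  rw [coe_aeval_eq_eval, hF]
  field_simp
  ring

/-- The discriminant, up to a factor `16`, of `y² = x³ + a x² + b x + c`. -/
def cubicDisc {R : Type*} [CommRing R] (a b c : R) : R :=
  a ^ 2 * b ^ 2 - 4 * b ^ 3 - 4 * a ^ 3 * c + 18 * a * b * c - 27 * c ^ 2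

theorem infinite_j_of_family (p : ℕ) [Fact p.Prime] (hp : p ≠ 2) (A B C : ℤ[X]) (s e : ℤ)
    {α β γ : ZMod p} (hα : (A.eval s : ℤ) = α) (hβ : (B.eval s : ℤ) = β) (hγ : (C.eval s : ℤ) = γ)
    (hΔ : cubicDisc α β γ ≠ 0)
    (hns : ∀ P ∈ affinePoints p α β γ, P.2 = 0 → 3 * P.1 ^ 2 + 2 * α * P.1 + β ≠ 0)
    {G : Type*} [AddCommGroup G] [Finite G] (hG : (affinePoints p α β γ).card + 1 ≤ Nat.card G)
    (hG' : ∀ t a b c : ℤ, (t : ZMod p) = s → A.eval t = a → B.eval t = b → C.eval t = c →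
      (monicCubicCurve (a : ℚ) b c).IsElliptic →
      ∃ f : G →+ (monicCubicCurve (a : ℚ) b c).toAffine.Point, Function.Injective f)
    (he : cubicDisc (A.eval e) (B.eval e) (C.eval e) = 0)
    (he' : A.eval e ^ 2 - 3 * B.eval e ≠ 0) :
    {j : ℚ | ∃ (E : WeierstrassCurve ℚ) (hE : E.IsElliptic), @WeierstrassCurve.j ℚ _ E hE = j ∧
      Nonempty (AddCommGroup.torsion E.toAffine.Point ≃+ G)}.Infinite := by
  have hcast (Q : ℤ[X]) {t : ℤ} (ht : (t : ZMod p) = s) :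
      ((Q.eval t : ℤ) : ZMod p) = (Q.eval s : ℤ) := by
    rw [ZMod.intCast_eq_intCast_iff_dvd_sub] at ht ⊢
    exact ht.trans (sub_dvd_eval_sub _ _ _)
  let D : ℤ[X] := 16 * cubicDisc A B C
  let U : ℤ[X] := 16 * (A ^ 2 - 3 * B)
  have hD (t : ℤ) : D.eval t = 16 * cubicDisc (A.eval t) (B.eval t) (C.eval t) := by
    simp [D, cubicDisc]
  have hU (t : ℤ) : U.eval t = 16 * (A.eval t ^ 2 - 3 * B.eval t) := by
    simp [U]
  have hp0 : (p : ℤ) ≠ 0 := by exact_mod_cast (Fact.out : p.Prime).ne_zero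
  have hS : {t : ℤ | (t : ZMod p) = s}.Infinite := by
    refine Set.infinite_of_injective_forall_mem (f := fun k : ℤ => s + p * k) ?_ ?_
    · intro k l h
      simpa [hp0, (Fact.out : p.Prime).ne_zero] using h
    · intro k
      simp
  have hSD (t : ℤ) (ht : (t : ZMod p) = s) : D.eval t ≠ 0 := by
    rw [hD]
    refine mul_ne_zero (by norm_num) (Int.ne_of_cast_zmod_ne p ?_)
    have : ((cubicDisc (A.eval t) (B.eval t) (C.eval t) : ℤ) : ZMod p) = cubicDisc α β γ := by
      rw [← hα, ← hβ, ← hγ, ← hcast A ht, ← hcast B ht, ← hcast C ht]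
      simp [cubicDisc]
    rw [this]
    simpa using hΔ
  refine (infinite_image_eval_pow_div_eval (U := U) (D := D) (e := e) (by simp [hD, he])
    (by rw [hU]; exact mul_ne_zero (by norm_num) he') hS hSD 3).mono ?_
  rintro _ ⟨t, ht, rfl⟩
  have hDt : (monicCubicCurve ((A.eval t : ℤ) : ℚ) (B.eval t : ℤ) (C.eval t : ℤ)).Δ =
      (D.eval t : ℤ) := by
    rw [monicCubicCurve_Δ, hD]
    simp [cubicDisc]
  have hE : (monicCubicCurve ((A.eval t : ℤ) : ℚ) (B.eval t : ℤ) (C.eval t : ℤ)).IsElliptic := by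
    rw [isElliptic_iff, hDt, isUnit_iff_ne_zero]
    exact_mod_cast hSD t ht
  obtain ⟨f, hf⟩ := hG' t _ _ _ ht rfl rfl rfl hE
  refine ⟨_, hE, ?_, nonempty_torsion_addEquiv hp ?_ ?_ f hf⟩
  · rw [WeierstrassCurve.j, Units.val_inv_eq_inv_val, coe_Δ', hDt, monicCubicCurve_c₄]
    simp only [hU]
    push_cast
    rw [div_eq_inv_mul]
  · rwa [hcast A ht, hcast B ht, hcast C ht, hα, hβ, hγ]
  · rwa [hcast A ht, hcast B ht, hcast C ht, hα, hβ, hγ]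

end Families

section TorsionFamilies

open Polynomial

instance fact_prime_five : Fact (Nat.Prime 5) := ⟨by norm_num⟩

instance fact_prime_seven : Fact (Nat.Prime 7) := ⟨by norm_num⟩

instance fact_prime_eleven : Fact (Nat.Prime 11) := ⟨by norm_num⟩

theorem infinite_j_zmod_one :
    {j : ℚ | ∃ (E : WeierstrassCurve ℚ) (hE : E.IsElliptic), @WeierstrassCurve.j ℚ _ E hE = j ∧
      Nonempty (AddCommGroup.torsion E.toAffine.Point ≃+ ZMod 1)}.Infinite := by
  refine infinite_j_of_family 3 (by norm_num) (X) (X - 1) (X - 1) 0 1 (α := 0) (β := 2) (γ := 2)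
      (by norm_num) (by norm_num; decide) (by norm_num; decide) (by decide) (by decide)
      (by simp only [Nat.card_eq_fintype_card]; decide) ?_ (by norm_num [cubicDisc]) (by norm_num)
  intros
  exact ⟨0, Function.injective_of_subsingleton _⟩

theorem infinite_j_zmod_two :
    {j : ℚ | ∃ (E : WeierstrassCurve ℚ) (hE : E.IsElliptic), @WeierstrassCurve.j ℚ _ E hE = j ∧
      Nonempty (AddCommGroup.torsion E.toAffine.Point ≃+ ZMod 2)}.Infinite := by
  refine infinite_j_of_family 3 (by norm_num) (2) (X) (0) 2 0 (α := 2) (β := 2) (γ := 0)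
      (by norm_num) (by norm_num) (by norm_num) (by decide) (by decide)
      (by simp only [Nat.card_eq_fintype_card]; decide) ?_ (by norm_num [cubicDisc]) (by norm_num)
  intro t a b c ht ha hb hc hE
  simp only [eval_X, eval_zero, eval_ofNat] at ha hb hc
  subst ha hb hc
  obtain ⟨P, h1⟩ := exists_hasCoords hE 0 0 (by ring)
  have h0 : 2 • P = 0 := h1.add_nsmul_eq_zero h1 (by ring) rfl
  have hP := addOrderOf_eq_of_nsmul_ne_zero h0 h1.ne_zero h1.ne_zero (by decide) (by norm_num)
  obtain ⟨f, hf, -⟩ := exists_injective_zmod hP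
  exact ⟨f, hf⟩

theorem infinite_j_zmod_three :
    {j : ℚ | ∃ (E : WeierstrassCurve ℚ) (hE : E.IsElliptic), @WeierstrassCurve.j ℚ _ E hE = j ∧
      Nonempty (AddCommGroup.torsion E.toAffine.Point ≃+ ZMod 3)}.Infinite := by
  refine infinite_j_of_family 3 (by norm_num) (X ^ 2) (8 * X) (16) 1 3 (α := 1) (β := 2) (γ := 1)
      (by norm_num) (by norm_num; decide) (by norm_num; decide) (by decide) (by decide)
      (by simp only [Nat.card_eq_fintype_card]; decide) ?_ (by norm_num [cubicDisc]) (by norm_num)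
  intro t a b c ht ha hb hc hE
  simp only [eval_mul, eval_pow, eval_X, eval_ofNat] at ha hb hc
  subst ha hb hc
  obtain ⟨P, h1⟩ := exists_hasCoords hE 0 4 (by ring)
  have h2 := h1.double (k := 2) t 0 (-4) (Int.ne_of_cast_zmod_ne 3 (by decide)) (by ring)
      (by ring) (by ring) rfl
  have h0 : 3 • P = 0 := h2.add_nsmul_eq_zero h1 (by ring) rfl
  have hP := addOrderOf_eq_of_nsmul_ne_zero h0 h1.ne_zero h1.ne_zero (by decide) (by norm_num)
  obtain ⟨f, hf, -⟩ := exists_injective_zmod hP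
  exact ⟨f, hf⟩

theorem infinite_j_zmod_four :
    {j : ℚ | ∃ (E : WeierstrassCurve ℚ) (hE : E.IsElliptic), @WeierstrassCurve.j ℚ _ E hE = j ∧
      Nonempty (AddCommGroup.torsion E.toAffine.Point ≃+ ZMod 4)}.Infinite := by
  refine infinite_j_of_family 3 (by norm_num) (8 * X + 1) (16 * X ^ 2) (0) 1 0 (α := 0) (β := 1)
      (γ := 0) (by norm_num; decide) (by norm_num; decide) (by norm_num) (by decide) (by decide)
      (by simp only [Nat.card_eq_fintype_card]; decide) ?_ (by norm_num [cubicDisc]) (by norm_num)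
  intro t a b c ht ha hb hc hE
  simp only [eval_add, eval_mul, eval_pow, eval_X, eval_one, eval_zero, eval_ofNat] at ha hb hc
  subst ha hb hc
  obtain ⟨P, h1⟩ := exists_hasCoords hE (-4 * t) (-4 * t) (by ring)
  have h2 := h1.double (k := 2) 1 0 0 (Int.ne_of_cast_zmod_ne 3 (by push_cast; rw [ht]; decide))
      (by ring) (by ring) (by ring) rfl
  have h0 : 4 • P = 0 := h2.add_nsmul_eq_zero h2 (by ring) rfl
  have hP := addOrderOf_eq_of_nsmul_ne_zero h0 h2.ne_zero h2.ne_zero (by decide) (by norm_num)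
  obtain ⟨f, hf, -⟩ := exists_injective_zmod hP
  exact ⟨f, hf⟩

theorem infinite_j_zmod_five :
    {j : ℚ | ∃ (E : WeierstrassCurve ℚ) (hE : E.IsElliptic), @WeierstrassCurve.j ℚ _ E hE = j ∧
      Nonempty (AddCommGroup.torsion E.toAffine.Point ≃+ ZMod 5)}.Infinite := by
  refine infinite_j_of_family 3 (by norm_num) (X ^ 2 - 6 * X + 1) (8 * X ^ 2 - 8 * X) (16 * X ^ 2)
      1 0 (α := 2) (β := 0) (γ := 1) (by norm_num; decide) (by norm_num) (by norm_num; decide)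
      (by decide) (by decide) (by simp only [Nat.card_eq_fintype_card]; decide) ?_
      (by norm_num [cubicDisc]) (by norm_num)
  intro t a b c ht ha hb hc hE
  simp only [eval_add, eval_sub, eval_mul, eval_pow, eval_X, eval_one, eval_ofNat] at ha hb hc
  subst ha hb hc
  obtain ⟨P, h1⟩ := exists_hasCoords hE 0 (-4 * t) (by ring)
  have h2 := h1.double (k := 2) (-t + 1) (4 * t) (4 * t ^ 2) (Int.ne_of_cast_zmod_ne 3
      (by push_cast; rw [ht]; decide)) (by ring) (by ring) (by ring) rfl
  have h4 := h2.double (k := 4) (t + 1) 0 (4 * t) (Int.ne_of_cast_zmod_ne 3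
      (by push_cast; rw [ht]; decide)) (by ring) (by ring) (by ring) rfl
  have h0 : 5 • P = 0 := h4.add_nsmul_eq_zero h1 (by ring) rfl
  have hP := addOrderOf_eq_of_nsmul_ne_zero h0 h1.ne_zero h1.ne_zero (by decide) (by norm_num)
  obtain ⟨f, hf, -⟩ := exists_injective_zmod hP
  exact ⟨f, hf⟩

theorem infinite_j_zmod_six :
    {j : ℚ | ∃ (E : WeierstrassCurve ℚ) (hE : E.IsElliptic), @WeierstrassCurve.j ℚ _ E hE = j ∧
      Nonempty (AddCommGroup.torsion E.toAffine.Point ≃+ ZMod 6)}.Infinite := by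
  refine infinite_j_of_family 3 (by norm_num) (-3 * X ^ 2 + 6 * X + 1) (-16 * X ^ 3) (0) 1 0 (α :=
      1) (β := 2) (γ := 0) (by norm_num; decide) (by norm_num; decide) (by norm_num) (by decide)
      (by decide) (by simp only [Nat.card_eq_fintype_card]; decide) ?_ (by norm_num [cubicDisc])
      (by norm_num)
  intro t a b c ht ha hb hc hE
  simp only [eval_add, eval_neg, eval_mul, eval_pow, eval_X, eval_one, eval_zero,
      eval_ofNat] at ha hb hc
  subst ha hb hc
  obtain ⟨P, h1⟩ := exists_hasCoords hE (-4 * t) (-4 * t ^ 2 - 4 * t) (by ring)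
  have h2 := h1.double (k := 2) (-t + 1) (4 * t ^ 2) (4 * t ^ 3 + 4 * t ^ 2)
      (Int.ne_of_cast_zmod_ne 3 (by push_cast; rw [ht]; decide)) (by ring) (by ring) (by ring) rfl
  have h3 := h2.add (k := 3) (t + 1) 0 0 h1 (Int.ne_of_cast_zmod_ne 3
      (by push_cast; rw [ht]; decide)) (by ring) (by ring) (by ring) rfl
  have h0 : 6 • P = 0 := h3.add_nsmul_eq_zero h3 (by ring) rfl
  have hP := addOrderOf_eq_of_nsmul_ne_zero h0 h2.ne_zero h3.ne_zero (by decide) (by norm_num)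
  obtain ⟨f, hf, -⟩ := exists_injective_zmod hP
  exact ⟨f, hf⟩

theorem infinite_j_zmod_seven :
    {j : ℚ | ∃ (E : WeierstrassCurve ℚ) (hE : E.IsElliptic), @WeierstrassCurve.j ℚ _ E hE = j ∧
      Nonempty (AddCommGroup.torsion E.toAffine.Point ≃+ ZMod 7)}.Infinite := by
  refine infinite_j_of_family 3 (by norm_num) (X ^ 4 - 6 * X ^ 3 + 3 * X ^ 2 + 2 * X + 1) (8 * X ^
      5 - 16 * X ^ 4 + 8 * X ^ 2) (16 * X ^ 6 - 32 * X ^ 5 + 16 * X ^ 4) 2 0 (α := 0) (β := 2) (γ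
      := 1) (by norm_num; decide) (by norm_num; decide) (by norm_num; decide) (by decide)
      (by decide) (by simp only [Nat.card_eq_fintype_card]; decide) ?_ (by norm_num [cubicDisc])
      (by norm_num)
  intro t a b c ht ha hb hc hE
  simp only [eval_add, eval_sub, eval_mul, eval_pow, eval_X, eval_one, eval_ofNat] at ha hb hc
  subst ha hb hc
  obtain ⟨P, h1⟩ := exists_hasCoords hE 0 (-4 * t ^ 3 + 4 * t ^ 2) (by ring)
  have h2 := h1.double (k := 2) (-t ^ 2 + t + 1) (4 * t ^ 3 - 4 * t ^ 2) (4 * t ^ 5 - 8 * t ^ 4 +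
      4 * t ^ 3) (Int.ne_of_cast_zmod_ne 3 (by push_cast; rw [ht]; decide)) (by ring) (by ring)
      (by ring) rfl
  have h4 := h2.double (k := 4) (t ^ 2 + t - 1) (4 * t ^ 2 - 4 * t) (4 * t ^ 4 - 12 * t ^ 3 + 12 *
      t ^ 2 - 4 * t) (Int.ne_of_cast_zmod_ne 3 (by push_cast; rw [ht]; decide)) (by ring)
      (by ring) (by ring) rfl
  have h8 := h4.double (k := 8) (t ^ 2 - 3 * t + 1) 0 (-4 * t ^ 3 + 4 * t ^ 2)
      (Int.ne_of_cast_zmod_ne 3 (by push_cast; rw [ht]; decide)) (by ring) (by ring) (by ring) rfl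
  have h0 : 7 • P = 0 := by
    obtain ⟨_, e1⟩ := h1
    obtain ⟨_, e8⟩ := h8
    have : 7 • P + 1 • P = 0 + 1 • P := by rw [← add_nsmul, zero_add, e1, e8]
    exact add_right_cancel this
  have hP := addOrderOf_eq_of_nsmul_ne_zero h0 h1.ne_zero h1.ne_zero (by decide) (by norm_num)
  obtain ⟨f, hf, -⟩ := exists_injective_zmod hP
  exact ⟨f, hf⟩

theorem infinite_j_zmod_eight :
    {j : ℚ | ∃ (E : WeierstrassCurve ℚ) (hE : E.IsElliptic), @WeierstrassCurve.j ℚ _ E hE = j ∧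
      Nonempty (AddCommGroup.torsion E.toAffine.Point ≃+ ZMod 8)}.Infinite := by
  refine infinite_j_of_family 5 (by norm_num) (8 * X ^ 4 - 16 * X ^ 3 + 16 * X ^ 2 - 8 * X + 1)
      (16 * X ^ 8 - 64 * X ^ 7 + 96 * X ^ 6 - 64 * X ^ 5 + 16 * X ^ 4) (0) 2 0 (α := 4) (β := 1)
      (γ := 0) (by norm_num; decide) (by norm_num; decide) (by norm_num) (by decide) (by decide)
      (by simp only [Nat.card_eq_fintype_card]; decide) ?_ (by norm_num [cubicDisc]) (by norm_num)
  intro t a b c ht ha hb hc hE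
  simp only [eval_add, eval_sub, eval_mul, eval_pow, eval_X, eval_one, eval_zero,
      eval_ofNat] at ha hb hc
  subst ha hb hc
  obtain ⟨P, h1⟩ := exists_hasCoords hE (-4 * t ^ 4 + 4 * t ^ 3) (-8 * t ^ 5 + 12 * t ^ 4 - 4 * t
      ^ 3) (by ring)
  have h2 := h1.double (k := 2) (-2 * t ^ 2 + 4 * t - 1) (4 * t ^ 4 - 8 * t ^ 3 + 4 * t ^ 2) (16 *
      t ^ 6 - 48 * t ^ 5 + 52 * t ^ 4 - 24 * t ^ 3 + 4 * t ^ 2) (Int.ne_of_cast_zmod_ne 5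
      (by push_cast; rw [ht]; decide)) (by ring) (by ring) (by ring) rfl
  have h4 := h2.double (k := 4) (4 * t ^ 2 - 4 * t + 1) 0 0 (Int.ne_of_cast_zmod_ne 5
      (by push_cast; rw [ht]; decide)) (by ring) (by ring) (by ring) rfl
  have h0 : 8 • P = 0 := h4.add_nsmul_eq_zero h4 (by ring) rfl
  have hP := addOrderOf_eq_of_nsmul_ne_zero h0 h4.ne_zero h4.ne_zero (by decide) (by norm_num)
  obtain ⟨f, hf, -⟩ := exists_injective_zmod hP
  exact ⟨f, hf⟩

theorem infinite_j_zmod_nine :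
    {j : ℚ | ∃ (E : WeierstrassCurve ℚ) (hE : E.IsElliptic), @WeierstrassCurve.j ℚ _ E hE = j ∧
      Nonempty (AddCommGroup.torsion E.toAffine.Point ≃+ ZMod 9)}.Infinite := by
  refine infinite_j_of_family 5 (by norm_num) (X ^ 6 - 6 * X ^ 5 + 9 * X ^ 4 - 10 * X ^ 3 + 6 * X
      ^ 2 + 1) (8 * X ^ 8 - 24 * X ^ 7 + 32 * X ^ 6 - 32 * X ^ 5 + 24 * X ^ 4 - 16 * X ^ 3 + 8 * X
      ^ 2) (16 * X ^ 10 - 64 * X ^ 9 + 128 * X ^ 8 - 160 * X ^ 7 + 128 * X ^ 6 - 64 * X ^ 5 + 16 *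
      X ^ 4) 2 0 (α := 1) (β := 3) (γ := 4) (by norm_num; decide) (by norm_num; decide)
      (by norm_num; decide) (by decide) (by decide)
      (by simp only [Nat.card_eq_fintype_card]; decide) ?_ (by norm_num [cubicDisc]) (by norm_num)
  intro t a b c ht ha hb hc hE
  simp only [eval_add, eval_sub, eval_mul, eval_pow, eval_X, eval_one, eval_ofNat] at ha hb hc
  subst ha hb hc
  obtain ⟨P, h1⟩ := exists_hasCoords hE 0 (-4 * t ^ 5 + 8 * t ^ 4 - 8 * t ^ 3 + 4 * t ^ 2)
      (by ring)
  have h2 := h1.double (k := 2) (-t ^ 3 + t ^ 2 + 1) (4 * t ^ 5 - 8 * t ^ 4 + 8 * t ^ 3 - 4 * t ^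
      2) (4 * t ^ 8 - 12 * t ^ 7 + 16 * t ^ 6 - 12 * t ^ 5 + 4 * t ^ 4) (Int.ne_of_cast_zmod_ne 5
      (by push_cast; rw [ht]; decide)) (by ring) (by ring) (by ring) rfl
  have h3 := h2.add (k := 3) (t ^ 3 - t ^ 2 + 1) (4 * t ^ 3 - 4 * t ^ 2) (-4 * t ^ 6 + 12 * t ^ 5
      - 12 * t ^ 4 + 4 * t ^ 3) h1 (Int.ne_of_cast_zmod_ne 5 (by push_cast; rw [ht]; decide))
      (by ring) (by ring) (by ring) rfl
  have h4 := h2.double (k := 4) (t ^ 3 + t ^ 2 - 2 * t + 1) (4 * t ^ 4 - 8 * t ^ 3 + 8 * t ^ 2 - 4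
      * t) (4 * t ^ 7 - 20 * t ^ 6 + 44 * t ^ 5 - 56 * t ^ 4 + 44 * t ^ 3 - 20 * t ^ 2 + 4 * t)
      (Int.ne_of_cast_zmod_ne 5 (by push_cast; rw [ht]; decide)) (by ring) (by ring) (by ring) rfl
  have h8 := h4.double (k := 8) (t ^ 3 - 3 * t ^ 2 + 4 * t - 1) 0 (4 * t ^ 5 - 8 * t ^ 4 + 8 * t ^
      3 - 4 * t ^ 2) (Int.ne_of_cast_zmod_ne 5 (by push_cast; rw [ht]; decide)) (by ring)
      (by ring) (by ring) rfl
  have h0 : 9 • P = 0 := h8.add_nsmul_eq_zero h1 (by ring) rfl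
  have hP := addOrderOf_eq_of_nsmul_ne_zero h0 h3.ne_zero h3.ne_zero (by decide) (by norm_num)
  obtain ⟨f, hf, -⟩ := exists_injective_zmod hP
  exact ⟨f, hf⟩

theorem infinite_j_zmod_ten :
    {j : ℚ | ∃ (E : WeierstrassCurve ℚ) (hE : E.IsElliptic), @WeierstrassCurve.j ℚ _ E hE = j ∧
      Nonempty (AddCommGroup.torsion E.toAffine.Point ≃+ ZMod 10)}.Infinite := by
  refine infinite_j_of_family 5 (by norm_num) (-8 * X ^ 6 + 32 * X ^ 5 - 40 * X ^ 4 + 20 * X ^ 3 -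
      4 * X + 1) (16 * X ^ 12 - 128 * X ^ 11 + 416 * X ^ 10 - 720 * X ^ 9 + 720 * X ^ 8 - 416 * X
      ^ 7 + 128 * X ^ 6 - 16 * X ^ 5) (0) 2 0 (α := 0) (β := 3) (γ := 0) (by norm_num; decide)
      (by norm_num; decide) (by norm_num) (by decide) (by decide)
      (by simp only [Nat.card_eq_fintype_card]; decide) ?_ (by norm_num [cubicDisc]) (by norm_num)
  intro t a b c ht ha hb hc hE
  simp only [eval_add, eval_sub, eval_neg, eval_mul, eval_pow, eval_X, eval_one, eval_zero,
      eval_ofNat] at ha hb hc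
  subst ha hb hc
  obtain ⟨P, h1⟩ := exists_hasCoords hE (4 * t ^ 6 - 16 * t ^ 5 + 16 * t ^ 4 - 4 * t ^ 3) (8 * t ^
      7 - 36 * t ^ 6 + 48 * t ^ 5 - 24 * t ^ 4 + 4 * t ^ 3) (by ring)
  have h2 := h1.double (k := 2) (-2 * t ^ 3 + 2 * t ^ 2 + 2 * t - 1) (4 * t ^ 6 - 8 * t ^ 5 + 4 *
      t ^ 4) (16 * t ^ 8 - 48 * t ^ 7 + 52 * t ^ 6 - 24 * t ^ 5 + 4 * t ^ 4)
      (Int.ne_of_cast_zmod_ne 5 (by push_cast; rw [ht]; decide)) (by ring) (by ring) (by ring) rfl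
  have h4 := h2.double (k := 4) (2 * t ^ 3 - 2 * t + 1) (4 * t ^ 6 - 16 * t ^ 5 + 24 * t ^ 4 - 16
      * t ^ 3 + 4 * t ^ 2) (8 * t ^ 7 - 36 * t ^ 6 + 64 * t ^ 5 - 56 * t ^ 4 + 24 * t ^ 3 - 4 * t
      ^ 2) (Int.ne_of_cast_zmod_ne 5 (by push_cast; rw [ht]; decide)) (by ring) (by ring)
      (by ring) rfl
  have h5 := h4.add (k := 5) (2 * t - 1) 0 0 h1 (Int.ne_of_cast_zmod_ne 5
      (by push_cast; rw [ht]; decide)) (by ring) (by ring) (by ring) rfl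
  have h0 : 10 • P = 0 := h5.add_nsmul_eq_zero h5 (by ring) rfl
  have hP := addOrderOf_eq_of_nsmul_ne_zero h0 h2.ne_zero h5.ne_zero (by decide) (by norm_num)
  obtain ⟨f, hf, -⟩ := exists_injective_zmod hP
  exact ⟨f, hf⟩

theorem infinite_j_zmod_twelve :
    {j : ℚ | ∃ (E : WeierstrassCurve ℚ) (hE : E.IsElliptic), @WeierstrassCurve.j ℚ _ E hE = j ∧
      Nonempty (AddCommGroup.torsion E.toAffine.Point ≃+ ZMod 12)}.Infinite := by
  refine infinite_j_of_family 7 (by norm_num) (24 * X ^ 8 + 96 * X ^ 7 + 216 * X ^ 6 + 312 * X ^ 5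
      + 288 * X ^ 4 + 168 * X ^ 3 + 60 * X ^ 2 + 12 * X + 1) (144 * X ^ 16 + 1152 * X ^ 15 + 4128
      * X ^ 14 + 8736 * X ^ 13 + 12112 * X ^ 12 + 11520 * X ^ 11 + 7632 * X ^ 10 + 3488 * X ^ 9 +
      1056 * X ^ 8 + 192 * X ^ 7 + 16 * X ^ 6) (0) 2 0 (α := 3) (β := 1) (γ := 0)
      (by norm_num; decide) (by norm_num; decide) (by norm_num) (by decide) (by decide)
      (by simp only [Nat.card_eq_fintype_card]; decide) ?_ (by norm_num [cubicDisc]) (by norm_num)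
  intro t a b c ht ha hb hc hE
  simp only [eval_add, eval_mul, eval_pow, eval_X, eval_one, eval_zero, eval_ofNat] at ha hb hc
  subst ha hb hc
  obtain ⟨P, h1⟩ := exists_hasCoords hE (-12 * t ^ 8 - 24 * t ^ 7 - 16 * t ^ 6 - 4 * t ^ 5) (-48 *
      t ^ 11 - 168 * t ^ 10 - 256 * t ^ 9 - 220 * t ^ 8 - 112 * t ^ 7 - 32 * t ^ 6 - 4 * t ^ 5)
      (by ring)
  have h2 := h1.double (k := 2) (6 * t ^ 4 + 16 * t ^ 3 + 14 * t ^ 2 + 6 * t + 1) (36 * t ^ 8 +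
      144 * t ^ 7 + 240 * t ^ 6 + 216 * t ^ 5 + 112 * t ^ 4 + 32 * t ^ 3 + 4 * t ^ 2) (-288 * t ^
      12 - 1728 * t ^ 11 - 4728 * t ^ 10 - 7800 * t ^ 9 - 8612 * t ^ 8 - 6656 * t ^ 7 - 3648 * t ^
      6 - 1400 * t ^ 5 - 360 * t ^ 4 - 56 * t ^ 3 - 4 * t ^ 2) (Int.ne_of_cast_zmod_ne 7
      (by push_cast; rw [ht]; decide)) (by ring) (by ring) (by ring) rfl
  have h4 := h2.double (k := 4) (-10 * t ^ 4 - 20 * t ^ 3 - 16 * t ^ 2 - 6 * t - 1) (4 * t ^ 8 +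
      16 * t ^ 7 + 24 * t ^ 6 + 16 * t ^ 5 + 4 * t ^ 4) (-32 * t ^ 12 - 192 * t ^ 11 - 504 * t ^
      10 - 760 * t ^ 9 - 724 * t ^ 8 - 448 * t ^ 7 - 176 * t ^ 6 - 40 * t ^ 5 - 4 * t ^ 4)
      (Int.ne_of_cast_zmod_ne 7 (by push_cast; rw [ht]; decide)) (by ring) (by ring) (by ring) rfl
  have h6 := h4.add (k := 6) (-8 * t ^ 4 - 16 * t ^ 3 - 14 * t ^ 2 - 6 * t - 1) 0 0 h2
      (Int.ne_of_cast_zmod_ne 7 (by push_cast; rw [ht]; decide)) (by ring) (by ring) (by ring) rfl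
  have h0 : 12 • P = 0 := h6.add_nsmul_eq_zero h6 (by ring) rfl
  have hP := addOrderOf_eq_of_nsmul_ne_zero h0 h4.ne_zero h6.ne_zero (by decide) (by norm_num)
  obtain ⟨f, hf, -⟩ := exists_injective_zmod hP
  exact ⟨f, hf⟩

theorem infinite_j_zmod_two_prod_zmod_two :
    {j : ℚ | ∃ (E : WeierstrassCurve ℚ) (hE : E.IsElliptic), @WeierstrassCurve.j ℚ _ E hE = j ∧
      Nonempty (AddCommGroup.torsion E.toAffine.Point ≃+ ZMod 2 × ZMod 2)}.Infinite := by
  refine infinite_j_of_family 3 (by norm_num) (X + 1) (X) (0) 2 0 (α := 0) (β := 2) (γ := 0)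
      (by norm_num; decide) (by norm_num) (by norm_num) (by decide) (by decide)
      (by simp only [Nat.card_eq_fintype_card]; decide) ?_ (by norm_num [cubicDisc]) (by norm_num)
  intro t a b c ht ha hb hc hE
  simp only [eval_add, eval_X, eval_one, eval_zero] at ha hb hc
  subst ha hb hc
  obtain ⟨P, h1⟩ := exists_hasCoords hE 0 0 (by ring)
  have h0 : 2 • P = 0 := h1.add_nsmul_eq_zero h1 (by ring) rfl
  have hP := addOrderOf_eq_of_nsmul_ne_zero h0 h1.ne_zero h1.ne_zero (by decide) (by norm_num)
  obtain ⟨T, hT⟩ := exists_hasCoords hE (-1) 0 (by ring)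
  exact exists_injective_zmod_two_prod (m := 1) (by norm_num) hP (hT.add_nsmul_eq_zero hT
      (by ring) rfl) (one_nsmul T ▸ hT.ne_zero) (one_nsmul T ▸ hT.ne h1 (Int.ne_of_cast_zmod_ne 3
      (by decide)))

theorem infinite_j_zmod_two_prod_zmod_four :
    {j : ℚ | ∃ (E : WeierstrassCurve ℚ) (hE : E.IsElliptic), @WeierstrassCurve.j ℚ _ E hE = j ∧
      Nonempty (AddCommGroup.torsion E.toAffine.Point ≃+ ZMod 2 × ZMod 4)}.Infinite := by
  refine infinite_j_of_family 5 (by norm_num) (X ^ 2 + 1) (X ^ 2) (0) 2 0 (α := 0) (β := 4) (γ :=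
      0) (by norm_num; decide) (by norm_num) (by norm_num) (by decide) (by decide)
      (by simp only [Nat.card_eq_fintype_card]; decide) ?_ (by norm_num [cubicDisc]) (by norm_num)
  intro t a b c ht ha hb hc hE
  simp only [eval_add, eval_pow, eval_X, eval_one, eval_zero] at ha hb hc
  subst ha hb hc
  obtain ⟨P, h1⟩ := exists_hasCoords hE t (t ^ 2 + t) (by ring)
  have h2 := h1.double (k := 2) (t + 1) 0 0 (Int.ne_of_cast_zmod_ne 5
      (by push_cast; rw [ht]; decide)) (by ring) (by ring) (by ring) rfl
  have h0 : 4 • P = 0 := h2.add_nsmul_eq_zero h2 (by ring) rfl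
  have hP := addOrderOf_eq_of_nsmul_ne_zero h0 h2.ne_zero h2.ne_zero (by decide) (by norm_num)
  obtain ⟨T, hT⟩ := exists_hasCoords hE (-1) 0 (by ring)
  exact exists_injective_zmod_two_prod (m := 2) (by norm_num) hP (hT.add_nsmul_eq_zero hT
      (by ring) rfl) (one_nsmul T ▸ hT.ne_zero) (one_nsmul T ▸ hT.ne h2 (Int.ne_of_cast_zmod_ne 5
      (by decide)))

theorem infinite_j_zmod_two_prod_zmod_six :
    {j : ℚ | ∃ (E : WeierstrassCurve ℚ) (hE : E.IsElliptic), @WeierstrassCurve.j ℚ _ E hE = j ∧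
      Nonempty (AddCommGroup.torsion E.toAffine.Point ≃+ ZMod 2 × ZMod 6)}.Infinite := by
  refine infinite_j_of_family 7 (by norm_num) (X ^ 4 + 2 * X ^ 3 + 2 * X + 1) (2 * X ^ 5 + 5 * X ^
      4 + 2 * X ^ 3) (0) 2 0 (α := 2) (β := 6) (γ := 0) (by norm_num; decide)
      (by norm_num; decide) (by norm_num) (by decide) (by decide)
      (by simp only [Nat.card_eq_fintype_card]; decide) ?_ (by norm_num [cubicDisc]) (by norm_num)
  intro t a b c ht ha hb hc hE
  simp only [eval_add, eval_mul, eval_pow, eval_X, eval_one, eval_zero, eval_ofNat] at ha hb hc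
  subst ha hb hc
  obtain ⟨P, h1⟩ := exists_hasCoords hE (2 * t ^ 3 + 5 * t ^ 2 + 2 * t) (2 * t ^ 5 + 9 * t ^ 4 +
      14 * t ^ 3 + 9 * t ^ 2 + 2 * t) (by ring)
  have h2 := h1.double (k := 2) (t ^ 2 + 3 * t + 1) (t ^ 2) (t ^ 4 + 2 * t ^ 3 + t ^ 2)
      (Int.ne_of_cast_zmod_ne 7 (by push_cast; rw [ht]; decide)) (by ring) (by ring) (by ring) rfl
  have h3 := h2.add (k := 3) (t ^ 2 + 2 * t + 1) 0 0 h1 (Int.ne_of_cast_zmod_ne 7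
      (by push_cast; rw [ht]; decide)) (by ring) (by ring) (by ring) rfl
  have h0 : 6 • P = 0 := h3.add_nsmul_eq_zero h3 (by ring) rfl
  have hP := addOrderOf_eq_of_nsmul_ne_zero h0 h2.ne_zero h3.ne_zero (by decide) (by norm_num)
  obtain ⟨T, hT⟩ := exists_hasCoords hE (-2 * t - 1) 0 (by ring)
  exact exists_injective_zmod_two_prod (m := 3) (by norm_num) hP (hT.add_nsmul_eq_zero hT
      (by ring) rfl) (one_nsmul T ▸ hT.ne_zero) (one_nsmul T ▸ hT.ne h3 (Int.ne_of_cast_zmod_ne 7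
      (by push_cast; rw [ht]; decide)))

set_option maxRecDepth 2000 in
theorem infinite_j_zmod_two_prod_zmod_eight :
    {j : ℚ | ∃ (E : WeierstrassCurve ℚ) (hE : E.IsElliptic), @WeierstrassCurve.j ℚ _ E hE = j ∧
      Nonempty (AddCommGroup.torsion E.toAffine.Point ≃+ ZMod 2 × ZMod 8)}.Infinite := by
  refine infinite_j_of_family 11 (by norm_num) (X ^ 8 - 4 * X ^ 6 + 22 * X ^ 4 - 4 * X ^ 2 + 1)
      (16 * X ^ 12 - 64 * X ^ 10 + 96 * X ^ 8 - 64 * X ^ 6 + 16 * X ^ 4) (0) 2 0 (α := 7) (β := 1)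
      (γ := 0) (by norm_num; decide) (by norm_num; decide) (by norm_num) (by decide) (by decide)
      (by simp only [Nat.card_eq_fintype_card]; decide) ?_ (by norm_num [cubicDisc]) (by norm_num)
  intro t a b c ht ha hb hc hE
  simp only [eval_add, eval_sub, eval_mul, eval_pow, eval_X, eval_one, eval_zero,
      eval_ofNat] at ha hb hc
  subst ha hb hc
  obtain ⟨P, h1⟩ := exists_hasCoords hE (4 * t ^ 7 + 8 * t ^ 6 - 8 * t ^ 4 - 4 * t ^ 3) (4 * t ^
      11 + 16 * t ^ 10 + 16 * t ^ 9 - 8 * t ^ 7 - 16 * t ^ 6 - 16 * t ^ 5 + 4 * t ^ 3) (by ring)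
  have h2 := h1.double (k := 2) (t ^ 4 + 4 * t ^ 3 - 1) (4 * t ^ 6 - 8 * t ^ 4 + 4 * t ^ 2) (4 * t
      ^ 10 - 8 * t ^ 6 + 4 * t ^ 2) (Int.ne_of_cast_zmod_ne 11 (by push_cast; rw [ht]; decide))
      (by ring) (by ring) (by ring) rfl
  have h4 := h2.double (k := 4) (t ^ 4 + 2 * t ^ 2 + 1) 0 0 (Int.ne_of_cast_zmod_ne 11
      (by push_cast; rw [ht]; decide)) (by ring) (by ring) (by ring) rfl
  have h0 : 8 • P = 0 := h4.add_nsmul_eq_zero h4 (by ring) rfl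
  have hP := addOrderOf_eq_of_nsmul_ne_zero h0 h4.ne_zero h4.ne_zero (by decide) (by norm_num)
  obtain ⟨T, hT⟩ := exists_hasCoords hE (-t ^ 8 + 4 * t ^ 6 - 6 * t ^ 4 + 4 * t ^ 2 - 1) 0
      (by ring)
  exact exists_injective_zmod_two_prod (m := 4) (by norm_num) hP (hT.add_nsmul_eq_zero hT
      (by ring) rfl) (one_nsmul T ▸ hT.ne_zero) (one_nsmul T ▸ hT.ne h4 (Int.ne_of_cast_zmod_ne 11
      (by push_cast; rw [ht]; decide)))

end TorsionFamilies

theorem infinitely_many_j_invariants_for_each_torsion_group :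
    (∀ n ∈ ({1, 2, 3, 4, 5, 6, 7, 8, 9, 10, 12} : Finset ℕ),
      {j : ℚ | ∃ (E : WeierstrassCurve ℚ) (hE : E.IsElliptic),
        @WeierstrassCurve.j ℚ _ E hE = j ∧
        Nonempty (AddCommGroup.torsion E.toAffine.Point ≃+ ZMod n)}.Infinite) ∧
    (∀ m ∈ ({1, 2, 3, 4} : Finset ℕ),
      {j : ℚ | ∃ (E : WeierstrassCurve ℚ) (hE : E.IsElliptic),
        @WeierstrassCurve.j ℚ _ E hE = j ∧
        Nonempty (AddCommGroup.torsion E.toAffine.Point ≃+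
          ZMod 2 × ZMod (2 * m))}.Infinite) := by
  refine ⟨fun n hn => ?_, fun m hm => ?_⟩
  · fin_cases hn
    exacts [infinite_j_zmod_one, infinite_j_zmod_two, infinite_j_zmod_three, infinite_j_zmod_four,
      infinite_j_zmod_five, infinite_j_zmod_six, infinite_j_zmod_seven, infinite_j_zmod_eight,
      infinite_j_zmod_nine, infinite_j_zmod_ten, infinite_j_zmod_twelve]
  · fin_cases hm
    exacts [infinite_j_zmod_two_prod_zmod_two, infinite_j_zmod_two_prod_zmod_four,
      infinite_j_zmod_two_prod_zmod_six, infinite_j_zmod_two_prod_zmod_eight]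
end

section
/- The only pairs of rational numbers (x, y) satisfying y² = −x⁶ − 9x⁴ − 11x² + 37 are (x, y) = (1, 4), (1, −4), (−1, 4), (−1, −4). (Consequently the modular curve X₀(37), which has this hyperelliptic affine model, has exactly four ℚ-rational points: the two cusps and the images of the cusps under the hyperelliptic involution.) -/
/-- The ring `ℤ[ω]` of Eisenstein integers, with `ω² = -1 - ω`. -/
abbrev QuadraticAlgebra.Eisenstein : Type := QuadraticAlgebra ℤ (-1) (-1)

namespace QuadraticAlgebra.Eisenstein

lemma norm_eq (z : Eisenstein) : norm z = z.re ^ 2 - z.re * z.im + z.im ^ 2 := by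
  rw [norm_def]; ring

lemma norm_nonneg (z : Eisenstein) : 0 ≤ norm z := by
  rw [norm_eq]; nlinarith [sq_nonneg (2 * z.re - z.im), sq_nonneg z.im]

lemma eq_zero_of_norm_eq_zero {z : Eisenstein} (h : norm z = 0) : z = 0 := by
  rw [norm_eq] at h
  have hi : z.im ^ 2 = 0 := by nlinarith [sq_nonneg (2 * z.re - z.im), sq_nonneg z.im]
  have hi' : z.im = 0 := by simpa using hi
  have hr : z.re = 0 := by simpa [hi'] using h
  exact QuadraticAlgebra.ext hr hi'

lemma norm_pos {z : Eisenstein} (hz : z ≠ 0) : 0 < norm z :=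
  (norm_nonneg z).lt_of_ne fun h => hz (eq_zero_of_norm_eq_zero h.symm)

instance : NoZeroDivisors Eisenstein where
  eq_zero_or_eq_zero_of_mul_eq_zero {x y} h := by
    have : norm x * norm y = 0 := by rw [← map_mul, h, norm_zero]
    exact (mul_eq_zero.mp this).imp eq_zero_of_norm_eq_zero eq_zero_of_norm_eq_zero

instance : IsDomain Eisenstein := NoZeroDivisors.to_isDomain _

lemma exists_abs_two_mul_sub_le (m : ℤ) {n : ℤ} (hn : 0 < n) :
    ∃ q : ℤ, |2 * (m - n * q)| ≤ n := by
  refine ⟨(2 * m + n) / (2 * n), ?_⟩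
  have h1 := Int.emod_add_mul_ediv (2 * m + n) (2 * n)
  have h2 := Int.emod_nonneg (2 * m + n) (b := 2 * n) (by omega)
  have h3 := Int.emod_lt_of_pos (2 * m + n) (b := 2 * n) (by omega)
  rw [abs_le]
  constructor <;> linarith

lemma exists_norm_sub_mul_lt (x : Eisenstein) {y : Eisenstein} (hy : y ≠ 0) :
    ∃ q, norm (x - y * q) < norm y := by
  have hN := norm_pos hy
  obtain ⟨q₁, h₁⟩ := exists_abs_two_mul_sub_le (x * star y).re hN
  obtain ⟨q₂, h₂⟩ := exists_abs_two_mul_sub_le (x * star y).im hN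
  refine ⟨⟨q₁, q₂⟩, ?_⟩
  have key : norm (x - y * ⟨q₁, q₂⟩) * norm y =
      ((x * star y).re - norm y * q₁) ^ 2
        - ((x * star y).re - norm y * q₁) * ((x * star y).im - norm y * q₂)
        + ((x * star y).im - norm y * q₂) ^ 2 := by
    simp only [norm_eq, re_sub, im_sub, re_mul, im_mul, re_star, im_star]
    ring
  generalize (x * star y).re - norm y * q₁ = r at *
  generalize (x * star y).im - norm y * q₂ = s at *
  rw [abs_le] at h₁ h₂
  have : norm (x - y * ⟨q₁, q₂⟩) * norm y < norm y * norm y := by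
    rw [key]; nlinarith
  exact lt_of_mul_lt_mul_right this hN.le

instance : IsPrincipalIdealRing Eisenstein :=
  let _ : EuclideanDomain Eisenstein :=
    { quotient := fun x y => open Classical in
        if hy : y = 0 then 0 else (exists_norm_sub_mul_lt x hy).choose
      quotient_zero := fun x => by simp
      remainder := fun x y => open Classical in
        x - y * if hy : y = 0 then 0 else (exists_norm_sub_mul_lt x hy).choose
      quotient_mul_add_remainder_eq := fun x y => by ring
      r := fun x y => (norm x).natAbs < (norm y).natAbs
      r_wellFounded := (measure fun x : Eisenstein => (norm x).natAbs).wf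
      remainder_lt := fun x y hy => by
        rw [dif_neg hy]
        have := (exists_norm_sub_mul_lt x hy).choose_spec
        exact Int.natAbs_lt_natAbs_of_nonneg_of_lt (norm_nonneg _) this
      mul_left_not_lt := fun x y hy => by
        rw [not_lt, map_mul, Int.natAbs_mul]
        exact Nat.le_mul_of_pos_right _ (Int.natAbs_pos.mpr (norm_pos hy).ne') }
  inferInstance

lemma mul_star_self (z : Eisenstein) : z * star z = ((norm z : ℤ) : Eisenstein) := by
  rw [← algebraMap_norm_eq_mul_star]; rfl

lemma eq_of_norm_eq_one {u : Eisenstein} (hu : norm u = 1) :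
    ∃ s : ℤ, s ^ 2 = 1 ∧ (u = ⟨s, 0⟩ ∨ u = ⟨0, s⟩ ∨ u = ⟨-s, -s⟩) := by
  obtain ⟨m, n⟩ := u
  rw [norm_eq] at hu
  simp only at hu
  have hn : n ^ 2 ≤ 1 := by nlinarith [sq_nonneg (2 * m - n)]
  have hm : m ^ 2 ≤ 1 := by nlinarith [sq_nonneg (2 * n - m)]
  have hn' := abs_le.mp (sq_le_one_iff_abs_le_one n |>.mp hn)
  have hm' := abs_le.mp (sq_le_one_iff_abs_le_one m |>.mp hm)
  obtain ⟨h1, h2⟩ := hn'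
  obtain ⟨h3, h4⟩ := hm'
  interval_cases m <;> interval_cases n <;> simp at hu
  exacts [⟨1, by simp⟩, ⟨-1, by simp⟩, ⟨-1, by simp⟩, ⟨1, by simp⟩, ⟨1, by simp⟩, ⟨-1, by simp⟩]

/-- If `ℓ * N(M)` is a cube and `M` is coprime to the cofactor, then `M` is a cube up to a power
of `ω`, and `ℓ` is a cube. -/
lemma exists_eq_cube {m n l h : ℤ} (hh : h ≠ 0) (hl : l * (m ^ 2 - m * n + n ^ 2) = h ^ 3)
    (hcop : ∀ π : Eisenstein, Prime π → π ∣ ⟨m, n⟩ → π ∣ (h : Eisenstein) →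
      π ∣ star ⟨m, n⟩ ∨ π ∣ (l : Eisenstein) → False) :
    ∃ x y e : ℤ, h = (x ^ 2 - x * y + y ^ 2) * e ∧ l = e ^ 3 ∧
      let P := x ^ 3 - 3 * x * y ^ 2 + y ^ 3
      let Q := 3 * (x * y * (x - y))
      (m = P ∧ n = Q) ∨ (m = -Q ∧ n = P - Q) ∨ (m = Q - P ∧ n = -P) := by
  have hprod : (⟨m, n⟩ : Eisenstein) * (star ⟨m, n⟩ * (l : Eisenstein)) = (h : Eisenstein) ^ 3 := by
    rw [← mul_assoc, mul_star_self, norm_eq, mul_comm]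
    exact_mod_cast congrArg (Int.cast : ℤ → Eisenstein) hl
  have hh' : (h : Eisenstein) ≠ 0 := fun h0 => hh (by simpa using congrArg re h0)
  have hM : IsCoprime (⟨m, n⟩ : Eisenstein) (star ⟨m, n⟩ * (l : Eisenstein)) := by
    refine isCoprime_of_prime_dvd (fun h0 => ?_) fun π hπ h1 h2 => ?_
    · rw [h0.1, zero_mul] at hprod
      exact pow_ne_zero 3 hh' hprod.symm
    · refine hcop π hπ h1 ?_ (hπ.dvd_or_dvd h2)
      exact hπ.dvd_of_dvd_pow (hprod ▸ Dvd.dvd.mul_right h1 _)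
  obtain ⟨⟨x, y⟩, u, hu⟩ := exists_associated_pow_of_mul_eq_pow' hM hprod
  have hnu : norm (u : Eisenstein) = 1 := by
    have := isUnit_iff_norm_isUnit.mp u.isUnit
    rcases Int.isUnit_iff.mp this with h1 | h1
    · exact h1
    · have := norm_nonneg (u : Eisenstein); omega
  have hnorm : norm (⟨x, y⟩ : Eisenstein) ^ 3 = m ^ 2 - m * n + n ^ 2 := by
    have := congrArg norm hu
    rwa [map_mul, map_pow, hnu, mul_one, norm_eq ⟨m, n⟩] at this
  rw [norm_eq] at hnorm
  simp only at hnorm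
  obtain ⟨e, he⟩ : x ^ 2 - x * y + y ^ 2 ∣ h := by
    rw [← Int.pow_dvd_pow_iff (n := 3) (by norm_num), hnorm, ← hl]
    exact dvd_mul_left _ _
  have hN : (x ^ 2 - x * y + y ^ 2) ≠ 0 := by
    rintro h0; rw [h0, zero_mul] at he; exact hh he
  have hle : l = e ^ 3 := by
    rw [← hnorm, he, mul_pow, mul_comm] at hl
    exact mul_left_cancel₀ (pow_ne_zero 3 hN) hl
  obtain ⟨s, hs, hus⟩ := eq_of_norm_eq_one hnu
  have hs3 : s ^ 3 = s := by linear_combination s * hs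
  refine ⟨s * x, s * y, e, ?_, hle, ?_⟩
  · linear_combination he - (x ^ 2 - x * y + y ^ 2) * e * hs
  have hre := congrArg re hu
  have him := congrArg im hu
  have e1 : (s * x) ^ 3 - 3 * (s * x) * (s * y) ^ 2 + (s * y) ^ 3
      = s * (x ^ 3 - 3 * x * y ^ 2 + y ^ 3) := by
    linear_combination (x ^ 3 - 3 * x * y ^ 2 + y ^ 3) * hs3
  have e2 : 3 * ((s * x) * (s * y) * (s * x - s * y)) = s * (3 * (x * y * (x - y))) := by
    linear_combination 3 * (x * y * (x - y)) * hs3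
  simp only [e1, e2]
  rcases hus with hus | hus | hus <;> rw [hus] at hre him <;>
    simp only [pow_succ, pow_zero, one_mul, re_mul, im_mul] at hre him
  · exact Or.inl ⟨by linear_combination -hre, by linear_combination -him⟩
  · exact Or.inr (Or.inl ⟨by linear_combination -hre, by linear_combination -him⟩)
  · exact Or.inr (Or.inr ⟨by linear_combination -hre, by linear_combination -him⟩)

lemma not_prime_of_dvd {b c k s : ℤ} (hbc : IsCoprime b c) (hk : IsCoprime (3 * k) s)
    {π : Eisenstein} (hπ : Prime π) (hs : π ∣ (s : Eisenstein))
    (h1 : π ∣ (k : Eisenstein) * (b + c * (ω : Eisenstein)))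
    (h2 : π ∣ (k : Eisenstein) * (b + c * (ω : Eisenstein) ^ 2) ∨
      π ∣ (k : Eisenstein) * (b + c)) : False := by
  have hω : (ω : Eisenstein) ^ 2 + ω + 1 = 0 := by
    ext <;> simp [pow_two]
  generalize (ω : Eisenstein) = W at *
  have h : π ∣ 3 * (k : Eisenstein) * b ∧ π ∣ 3 * (k : Eisenstein) * c := by
    obtain ⟨p, hp⟩ := h1
    rcases h2 with ⟨q, hq⟩ | ⟨q, hq⟩
    · refine ⟨⟨(W ^ 2 - W) * (q * W - p * W ^ 2), ?_⟩, ⟨(W ^ 2 - W) * (p - q), ?_⟩⟩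
      · linear_combination (W ^ 2 - W) * (W * hq - W ^ 2 * hp) + k * b * (W ^ 2 - 3 * W + 3) * hω
      · linear_combination (W ^ 2 - W) * (hp - hq) + k * c * (W ^ 2 - 3 * W + 3) * hω
    · refine ⟨⟨(1 - W ^ 2) * (p - W * q), ?_⟩, ⟨(1 - W ^ 2) * (q - p), ?_⟩⟩
      · linear_combination (1 - W ^ 2) * (hp - W * hq) + k * b * (2 - W) * hω
      · linear_combination (1 - W ^ 2) * (hq - hp) + k * c * (2 - W) * hω
  obtain ⟨u, v, huv⟩ := hbc
  obtain ⟨w, t, hwt⟩ := hk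
  have huv' : (u : Eisenstein) * b + v * c = 1 := by
    exact_mod_cast congrArg (Int.cast : ℤ → Eisenstein) huv
  have hwt' : (w : Eisenstein) * (3 * k) + t * s = 1 := by
    exact_mod_cast congrArg (Int.cast : ℤ → Eisenstein) hwt
  refine hπ.not_isUnit (isUnit_of_dvd_one ?_)
  have : (1 : Eisenstein) = w * (u * (3 * k * b) + v * (3 * k * c)) + t * s := by
    linear_combination -hwt' - 3 * w * k * huv'
  rw [this]
  exact dvd_add (dvd_mul_of_dvd_right (dvd_add (dvd_mul_of_dvd_right h.1 _)
    (dvd_mul_of_dvd_right h.2 _)) _) (dvd_mul_of_dvd_right hs _)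

/-- The descent map: a triple with zero sum on the intermediate cubic gives a solution. -/
lemma descent_eq {e p q : ℤ} (h : e ^ 3 + p * q * (p + q) = 10 * e * (p ^ 2 + p * q + q ^ 2)) :
    (10 * e - p) + (10 * e - q) + (10 * e + p + q) = 10 * (3 * e) ∧
      (10 * e - p) * (10 * e - q) * (10 * e + p + q) = 37 * (3 * e) ^ 3 :=
  ⟨by ring, by linear_combination h⟩

/-- Descent step on `37a³ + b³ + c³ = 10abc` when `3 ∣ a`. -/
lemma exists_descent_of_three_dvd {b c g : ℤ} (hg : g ≠ 0) (hbc : IsCoprime b c)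
    (h : 37 * (3 * g) ^ 3 + b ^ 3 + c ^ 3 = 10 * (3 * g) * b * c) :
    ∃ A B C e : ℤ, A + B + C = 10 * (3 * e) ∧ A * B * C = 37 * (3 * e) ^ 3 ∧ e ≠ 0 ∧
      |3 * e| < |3 * g| := by
  have h3b : ¬ (3 : ℤ) ∣ b := by
    intro hb
    have hc : (3 : ℤ) ∣ c := by
      refine Int.prime_three.dvd_of_dvd_pow (n := 3) ?_
      obtain ⟨b, rfl⟩ := hb
      exact ⟨30 * g * b * c - 333 * g ^ 3 - 9 * b ^ 3, by linear_combination h⟩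
    exact Int.prime_three.not_isUnit (hbc.isUnit_of_dvd' hb hc)
  obtain ⟨m, rfl⟩ : ∃ m, c = 3 * m - b := by
    have : (3 : ℤ) ∣ b + c := by
      refine Int.prime_three.dvd_of_dvd_pow (n := 3) ?_
      exact ⟨10 * g * b * c - 333 * g ^ 3 + b ^ 2 * c + b * c ^ 2, by linear_combination h⟩
    obtain ⟨m, hm⟩ := this
    exact ⟨m, by linarith⟩
  have h3b_of_mul {r : ℤ} (hr : 3 ∣ r * b ^ 2) : 3 ∣ r :=
    (Int.prime_three.dvd_or_dvd hr).resolve_right fun h' => h3b (Int.prime_three.dvd_of_dvd_pow h')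
  obtain ⟨t, rfl⟩ : (3 : ℤ) ∣ g := h3b_of_mul
    ⟨10 * g * b * m - 111 * g ^ 3 - 3 * m ^ 3 + 3 * m ^ 2 * b - m * b ^ 2 - 3 * g * b ^ 2,
      by linarith [h]⟩
  obtain ⟨l, hl⟩ : (3 : ℤ) ∣ m + 10 * t := h3b_of_mul
    ⟨10 * t * b * m - 999 * t ^ 3 - m ^ 3 + m ^ 2 * b, by linarith [h]⟩
  obtain rfl : m = 3 * l - 10 * t := by linarith
  have ht : t ≠ 0 := by rintro rfl; exact hg rfl
  have hnorm : l * ((b - 3 * l) ^ 2 - (b - 3 * l) * (3 * l - 30 * t) + (3 * l - 30 * t) ^ 2)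
      = t ^ 3 := by linarith [h]
  have hcopN : IsCoprime (3 * 1 : ℤ)
      ((b - 3 * l) ^ 2 - (b - 3 * l) * (3 * l - 30 * t) + (3 * l - 30 * t) ^ 2) := by
    rw [mul_one, Int.prime_three.coprime_iff_not_dvd]
    rintro ⟨k, hk⟩
    refine h3b (Int.prime_three.dvd_of_dvd_pow (n := 2)
      ⟨k + 3 * b * l - 10 * b * t - 9 * l ^ 2 + 90 * l * t - 300 * t ^ 2, by linarith⟩)
  obtain ⟨x, y, e, hte, hle, hxy⟩ := exists_eq_cube ht hnorm <| by
    intro π hπ hM ht' hor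
    refine not_prime_of_dvd hbc hcopN hπ ?_ ?_ ?_
    · have := dvd_mul_of_dvd_left hM (star ⟨b - 3 * l, 3 * l - 30 * t⟩)
      rwa [mul_star_self, norm_eq] at this
    · have : ((1 : ℤ) : Eisenstein) * ((b : Eisenstein)
        + ((3 * (3 * l - 10 * t) - b : ℤ) : Eisenstein) * (ω : Eisenstein))
          = (⟨b - 3 * l, 3 * l - 30 * t⟩ : Eisenstein) * (1 - (ω : Eisenstein))
              - (t : Eisenstein) * (30 * (ω : Eisenstein) ^ 2) := by
        ext <;> simp [pow_two] <;> ring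
      rw [this]
      exact dvd_sub (dvd_mul_of_dvd_left hM _) (dvd_mul_of_dvd_left ht' _)
    · refine hor.imp (fun h' => ?_) fun h' => ?_
      · have : ((1 : ℤ) : Eisenstein) * ((b : Eisenstein)
          + ((3 * (3 * l - 10 * t) - b : ℤ) : Eisenstein) * (ω : Eisenstein) ^ 2)
            = star (⟨b - 3 * l, 3 * l - 30 * t⟩ : Eisenstein) * (1 - (ω : Eisenstein) ^ 2)
                - (t : Eisenstein) * (30 * (ω : Eisenstein)) := by
          ext <;> simp [pow_two] <;> ring
        rw [this]
        exact dvd_sub (dvd_mul_of_dvd_left h' _) (dvd_mul_of_dvd_left ht' _)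
      · have : ((1 : ℤ) : Eisenstein) * ((b : Eisenstein)
          + ((3 * (3 * l - 10 * t) - b : ℤ) : Eisenstein))
            = (l : Eisenstein) * 9 - (t : Eisenstein) * 30 := by
          push_cast; ring
        rw [this]
        exact dvd_sub (dvd_mul_of_dvd_left h' _) (dvd_mul_of_dvd_left ht' _)
  have he : e ≠ 0 := by rintro rfl; exact ht (by simpa using hte)
  have hN : x ^ 2 - x * y + y ^ 2 ≠ 0 := fun h0 => ht (by rw [hte, h0, zero_mul])
  have hlt : |3 * e| < |3 * (3 * t)| := by
    rw [hte, abs_mul, abs_mul, abs_mul, abs_mul]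
    norm_num
    nlinarith [abs_pos.mpr he, Int.one_le_abs hN]
  rcases hxy with ⟨h1, h2⟩ | ⟨h1, h2⟩ | ⟨h1, h2⟩
  · obtain ⟨hs, hp⟩ := descent_eq (e := e) (p := x) (q := -y)
      (by rw [hle, hte] at h2; linarith)
    exact ⟨_, _, _, e, hs, hp, he, hlt⟩
  · exact absurd ⟨l - x * y * (x - y), by linarith⟩ h3b
  · have : (3 : ℤ) ∣ x ^ 3 - 3 * x * y ^ 2 + y ^ 3 := ⟨10 * t - l, by linarith⟩
    obtain ⟨k, hk⟩ := this
    exact absurd ⟨l + x * y * (x - y) - k, by linarith⟩ h3b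

/-- Descent step on `37a³ + b³ + c³ = 10abc` when `3 ∤ a`. -/
lemma exists_descent_of_not_three_dvd {a b c : ℤ} (ha : ¬ (3 : ℤ) ∣ a) (hbc : IsCoprime b c)
    (h : 37 * a ^ 3 + b ^ 3 + c ^ 3 = 10 * a * b * c) :
    ∃ A B C e : ℤ, A + B + C = 10 * (3 * e) ∧ A * B * C = 37 * (3 * e) ^ 3 ∧ e ≠ 0 ∧
      |3 * e| < |a| := by
  have ha0 : a ≠ 0 := by rintro rfl; exact ha (dvd_zero 3)
  have hnorm : (3 * b + 3 * c + 10 * a) * ((3 * b - 10 * a) ^ 2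
      - (3 * b - 10 * a) * (3 * c - 10 * a) + (3 * c - 10 * a) ^ 2) = a ^ 3 := by
    linear_combination 27 * h
  have hcop3 : IsCoprime (3 : ℤ) a := (Int.prime_three.coprime_iff_not_dvd).mpr ha
  have hcop9 : IsCoprime (3 * 3 : ℤ) a := hcop3.mul_left hcop3
  obtain ⟨x, y, e, hae, hle, hxy⟩ := exists_eq_cube ha0 hnorm <| by
    intro π hπ hM ha' hor
    refine not_prime_of_dvd hbc hcop9 hπ ha' ?_ ?_
    · have : ((3 : ℤ) : Eisenstein) * ((b : Eisenstein) + (c : Eisenstein) * (ω : Eisenstein))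
          = (⟨3 * b - 10 * a, 3 * c - 10 * a⟩ : Eisenstein)
              - (a : Eisenstein) * (10 * (ω : Eisenstein) ^ 2) := by
        ext <;> simp [pow_two] <;> ring
      rw [this]
      exact dvd_sub hM (dvd_mul_of_dvd_left ha' _)
    · refine hor.imp (fun h' => ?_) fun h' => ?_
      · have : ((3 : ℤ) : Eisenstein) * ((b : Eisenstein) + (c : Eisenstein) * (ω : Eisenstein) ^ 2)
            = star (⟨3 * b - 10 * a, 3 * c - 10 * a⟩ : Eisenstein)
                - (a : Eisenstein) * (10 * (ω : Eisenstein)) := by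
          ext <;> simp [pow_two] <;> ring
        rw [this]
        exact dvd_sub h' (dvd_mul_of_dvd_left ha' _)
      · have : ((3 : ℤ) : Eisenstein) * ((b : Eisenstein) + (c : Eisenstein))
            = ((3 * b + 3 * c + 10 * a : ℤ) : Eisenstein) - a * 10 := by
          push_cast; ring
        rw [this]
        exact dvd_sub h' (dvd_mul_of_dvd_left ha' _)
  have he : e ≠ 0 := by rintro rfl; exact ha0 (by simpa using hae)
  rcases hxy with ⟨h1, h2⟩ | ⟨h1, h2⟩ | ⟨h1, h2⟩
  · exact absurd ⟨c - 3 * a - x * y * (x - y), by linarith⟩ ha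
  · exact absurd ⟨b - 3 * a + x * y * (x - y), by linarith⟩ ha
  · have hcubic : e ^ 3 + (x + y) * (2 * x - y) * (x - 2 * y)
        = 30 * e * (x ^ 2 - x * y + y ^ 2) := by
      linear_combination -hle + h1 + h2 + 30 * hae
    obtain ⟨hs, hp⟩ := descent_eq (e := e) (p := x + y) (q := y - 2 * x)
      (by linear_combination hcubic)
    refine ⟨_, _, _, e, hs, hp, he, ?_⟩
    have hN : 4 ≤ x ^ 2 - x * y + y ^ 2 := by
      by_contra! hlt
      have hx : |x| ≤ 2 := by
        rw [← sq_le_sq₀ (abs_nonneg x) (by norm_num), sq_abs]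
        nlinarith [sq_nonneg (2 * y - x)]
      have hy : |y| ≤ 2 := by
        rw [← sq_le_sq₀ (abs_nonneg y) (by norm_num), sq_abs]
        nlinarith [sq_nonneg (2 * x - y)]
      obtain ⟨hx1, hx2⟩ := abs_le.mp hx
      obtain ⟨hy1, hy2⟩ := abs_le.mp hy
      have h30 : |(x + y) * (2 * x - y) * (x - 2 * y)| = 2 → x ^ 2 - x * y + y ^ 2 ≠ 1 := by
        intro hk hN
        have hek := hcubic
        rw [hN, mul_one] at hek
        generalize (x + y) * (2 * x - y) * (x - 2 * y) = k at hk hek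
        have hdvd : e ∣ k := ⟨30 - e ^ 2, by linear_combination hek⟩
        have he2 : |e| ≤ 2 := hk ▸ Int.le_of_dvd (by omega) ((abs_dvd_abs e k).mpr hdvd)
        obtain ⟨he1, he2⟩ := abs_le.mp he2
        rcases abs_eq (by norm_num) |>.mp hk with rfl | rfl <;> interval_cases e <;> omega
      interval_cases x <;> interval_cases y <;> norm_num at hlt <;>
        norm_num at hae <;>
        first
        | exact ha0 hae
        | exact ha ⟨e, hae⟩
        | exact h30 (by norm_num) (by norm_num)
    rw [hae, abs_mul, abs_mul, abs_of_pos (by linarith : 0 < x ^ 2 - x * y + y ^ 2)]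
    norm_num
    nlinarith [abs_pos.mpr he]

end QuadraticAlgebra.Eisenstein

lemma Int.dvd_of_mul_eq_thirty_seven_mul_cube {A B C f p : ℤ} (hp : Prime p)
    (h : A * B * C = 37 * f ^ 3) (hA : p ∣ A) (hB : p ∣ B) : p ∣ f := by
  by_contra hf
  have hcop : IsCoprime (p ^ 2) (f ^ 3) := ((hp.coprime_iff_not_dvd).mpr hf).pow
  have hdvd : p * p ∣ 37 := by
    rw [← pow_two]
    refine hcop.dvd_of_dvd_mul_right ?_
    rw [← h, pow_two]
    exact Dvd.dvd.mul_right (mul_dvd_mul hA hB) C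
  have hsq : Squarefree (37 : ℤ) :=
    (Nat.prime_iff_prime_int.mp (by norm_num : Nat.Prime 37)).irreducible.squarefree
  exact hp.not_isUnit (hsq p hdvd)

/-- Descent step on `A + B + C = 10f`, `ABC = 37f³` when `A`, `B`, `C` are pairwise coprime. -/
lemma exists_descent_of_isCoprime {A B C f : ℤ} (hf : f ≠ 0) (hs : A + B + C = 10 * f)
    (h : A * B * C = 37 * f ^ 3) (hAB : IsCoprime A B) (hAC : IsCoprime A C) (hBC : IsCoprime B C)
    (hA : 37 ∣ A) :
    ∃ A' B' C' e : ℤ, A' + B' + C' = 10 * (3 * e) ∧ A' * B' * C' = 37 * (3 * e) ^ 3 ∧ e ≠ 0 ∧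
      |3 * e| < |f| := by
  have h3 : Odd 3 := by decide
  obtain ⟨A, rfl⟩ := hA
  replace h : A * B * C = f ^ 3 := by linarith
  have hAB' := hAB.of_mul_left_right
  have hAC' := hAC.of_mul_left_right
  obtain ⟨⟨d, hd⟩, c, rfl⟩ := Int.eq_pow_of_mul_eq_pow_odd (hAC'.mul_left hBC) h3 h
  obtain ⟨⟨a, rfl⟩, b, rfl⟩ := Int.eq_pow_of_mul_eq_pow_odd hAB' h3 hd
  obtain rfl : a * b * c = f := h3.strictMono_pow.injective (by rw [mul_pow, mul_pow]; exact h)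
  have hbc : IsCoprime b c := (IsCoprime.pow_iff (by norm_num) (by norm_num)).mp hBC
  have hcubic : 37 * a ^ 3 + b ^ 3 + c ^ 3 = 10 * a * b * c := by linear_combination hs
  have ha : a ≠ 0 := by rintro rfl; simp at hf
  have key : ∃ A' B' C' e : ℤ, A' + B' + C' = 10 * (3 * e) ∧ A' * B' * C' = 37 * (3 * e) ^ 3 ∧
      e ≠ 0 ∧ |3 * e| < |a| := by
    by_cases h3a : (3 : ℤ) ∣ a
    · obtain ⟨g, rfl⟩ := h3a
      exact QuadraticAlgebra.Eisenstein.exists_descent_of_three_dvd (by rintro rfl; exact ha rfl)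
        hbc hcubic
    · exact QuadraticAlgebra.Eisenstein.exists_descent_of_not_three_dvd h3a hbc hcubic
  obtain ⟨A', B', C', e, hs', hp', he, hlt⟩ := key
  exact ⟨A', B', C', e, hs', hp', he,
    hlt.trans_le (Int.le_of_dvd (abs_pos.mpr hf) ((abs_dvd_abs _ _).mpr ⟨b * c, by ring⟩))⟩

/-- The elliptic curve `A + B + C = 10f`, `ABC = 37f³` has only trivial integral solutions. -/
lemma eq_zero_of_add_eq_of_mul_eq {A B C f : ℤ} (hs : A + B + C = 10 * f)
    (h : A * B * C = 37 * f ^ 3) : f = 0 := by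
  induction hn : f.natAbs using Nat.strong_induction_on generalizing A B C f with
  | _ n ih =>
    subst hn
    by_contra hf
    have hcop : ∀ {A B C : ℤ}, A + B + C = 10 * f → A * B * C = 37 * f ^ 3 → IsCoprime A B := by
      intro A B C hs h
      refine isCoprime_of_prime_dvd (fun h0 => ?_) fun p hp hA hB => ?_
      · rw [h0.1, zero_mul, zero_mul] at h
        exact mul_ne_zero (by norm_num) (pow_ne_zero 3 hf) h.symm
      · obtain ⟨g, rfl⟩ := Int.dvd_of_mul_eq_thirty_seven_mul_cube hp h hA hB
        obtain ⟨A, rfl⟩ := hA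
        obtain ⟨B, rfl⟩ := hB
        obtain rfl : C = p * (10 * g - A - B) := by linear_combination hs
        have hg : g ≠ 0 := by rintro rfl; simp at hf
        refine hg (ih g.natAbs ?_ (A := A) (B := B) (C := 10 * g - A - B) (by ring) ?_ rfl)
        · rw [Int.natAbs_mul]
          have := Int.natAbs_pos.mpr hg
          have := (Int.prime_iff_natAbs_prime.mp hp).two_le
          nlinarith
        · exact mul_left_cancel₀ (pow_ne_zero 3 hp.ne_zero) (by linear_combination h)
    have step : ∀ {A B C : ℤ}, A + B + C = 10 * f → A * B * C = 37 * f ^ 3 → ¬ 37 ∣ A := by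
      intro A B C hs h hA
      obtain ⟨A', B', C', e, hs', h', he, hlt⟩ := exists_descent_of_isCoprime hf hs h (hcop hs h)
        (hcop (C := B) (by linarith) (by linarith)) (hcop (C := A) (by linarith) (by linarith)) hA
      have := ih (3 * e).natAbs (by zify; exact hlt) hs' h' rfl
      omega
    have h37 : Prime (37 : ℤ) := Nat.prime_iff_prime_int.mp (by norm_num : Nat.Prime 37)
    rcases h37.dvd_or_dvd (Dvd.intro _ h.symm) with hAB | hC
    · rcases h37.dvd_or_dvd hAB with hA | hB
      · exact step hs h hA
      · exact step (A := B) (B := A) (C := C) (by linarith) (by linarith) hB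
    · exact step (A := C) (B := A) (C := B) (by linarith) (by linarith) hC

lemma eq_zero_of_add_eq_of_mul_eq_rat {A B C f : ℚ} (hs : A + B + C = 10 * f)
    (h : A * B * C = 37 * f ^ 3) : f = 0 := by
  obtain ⟨d, hd⟩ := IsLocalization.exist_integer_multiples_of_finset (nonZeroDivisors ℤ)
    ({A, B, C, f} : Finset ℚ)
  obtain ⟨A', hA⟩ := hd A (by simp)
  obtain ⟨B', hB⟩ := hd B (by simp)
  obtain ⟨C', hC⟩ := hd C (by simp)
  obtain ⟨f', hf⟩ := hd f (by simp)
  have hd0 : ((d : ℤ) : ℚ) ≠ 0 := by exact_mod_cast nonZeroDivisors.coe_ne_zero d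
  simp only [algebraMap_int_eq, eq_intCast, zsmul_eq_mul] at hA hB hC hf
  have hf' : f' = 0 := eq_zero_of_add_eq_of_mul_eq (A := A') (B := B') (C := C')
    (by exact_mod_cast (by rw [hA, hB, hC, hf]; linear_combination (d : ℤ) * hs :
      (A' + B' + C' : ℚ) = 10 * f'))
    (by exact_mod_cast (by rw [hA, hB, hC, hf]; linear_combination ((d : ℤ) : ℚ) ^ 3 * h :
      (A' * B' * C' : ℚ) = 37 * f' ^ 3))
  rw [hf', Int.cast_zero] at hf
  exact (mul_eq_zero.mp hf.symm).resolve_left hd0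

/-- The only rational points on the affine model `y² = -x⁶ - 9x⁴ - 11x² + 37` of the modular
curve `X₀(37)` are `(±1, ±4)`. -/
theorem rational_points_X0_37 (x y : ℚ) :
    y ^ 2 = -x ^ 6 - 9 * x ^ 4 - 11 * x ^ 2 + 37 ↔
      (x = 1 ∨ x = -1) ∧ (y = 4 ∨ y = -4) := by
  have hint : (-(y - 10 * (x - x ^ 3) - 4 * x ^ 3)) + (y + 10 * (x - x ^ 3) + 4 * x ^ 3)
      + (-8 * x ^ 3) = 10 * (2 * (x - x ^ 3)) := by ring
  constructor
  · intro h
    have hf := eq_zero_of_add_eq_of_mul_eq_rat hint (by linear_combination -8 * x ^ 3 * (-h))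
    have hx : x * ((x - 1) * (x + 1)) = 0 := by linear_combination -hf / 2
    rcases mul_eq_zero.mp hx with rfl | hx
    · have h37 : IsSquare (37 : ℚ) := ⟨y, by linear_combination -h⟩
      rw [show (37 : ℚ) = ((37 : ℕ) : ℚ) by norm_num, Rat.isSquare_natCast_iff] at h37
      exact absurd h37 (by norm_num : Nat.Prime 37).prime.not_isSquare
    · have hx' : x = 1 ∨ x = -1 := (mul_eq_zero.mp hx).imp (by intro h; linarith)
        (by intro h; linarith)
      refine ⟨hx', ?_⟩
      have hy : (y - 4) * (y + 4) = 0 := by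
        rcases hx' with rfl | rfl <;> linear_combination h
      exact (mul_eq_zero.mp hy).imp (by intro h; linarith) (by intro h; linarith)
  · rintro ⟨rfl | rfl, rfl | rfl⟩ <;> norm_num
end

section
/- Let E₀ be the elliptic curve over ℚ with Weierstrass equation y² + y = x³ + x² − 23x − 50 (LMFDB label 37.b2). Then the Mordell–Weil group E₀(ℚ) is finite of order 3; equivalently, E₀(ℚ) is isomorphic to ℤ/3ℤ. -/
/-- The elliptic curve `E₀ : y² + y = x³ + x² - 23x - 50` over `ℚ` (LMFDB label 37.b2). -/
def E₀ : WeierstrassCurve ℚ := ⟨0, 1, 1, -23, -50⟩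

/-- The ring `ℤ[ω]` of Eisenstein integers, where `ω ^ 2 = -1 - ω`. -/
abbrev EisensteinInt : Type := QuadraticAlgebra ℤ (-1) (-1)

namespace EisensteinInt

open QuadraticAlgebra

lemma norm_eq (z : EisensteinInt) : z.norm = z.re ^ 2 - z.re * z.im + z.im ^ 2 := by
  rw [norm_def]; ring

lemma norm_nonneg (z : EisensteinInt) : 0 ≤ z.norm := by
  rw [norm_eq]; nlinarith [sq_nonneg (z.re - z.im), sq_nonneg z.re, sq_nonneg z.im]

lemma norm_pos {z : EisensteinInt} (hz : z ≠ 0) : 0 < z.norm := by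
  refine lt_of_le_of_ne (norm_nonneg z) fun h => hz ?_
  rw [norm_eq] at h
  have him : z.im = 0 := by nlinarith [sq_nonneg (2 * z.re - z.im), sq_nonneg z.im]
  have hre : z.re = 0 := by simpa [him] using h.symm
  ext <;> simp [him, hre]

/-- Division with rounding to a nearest Eisenstein integer. -/
def quot (x y : EisensteinInt) : EisensteinInt :=
  ⟨round ((x * star y).re / y.norm : ℚ), round ((x * star y).im / y.norm : ℚ)⟩

lemma two_mul_abs_sub_mul_round_le (m : ℤ) {n : ℤ} (hn : 0 < n) :
    2 * |m - n * round (m / n : ℚ)| ≤ n := by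
  have hn' : (0 : ℚ) < n := by exact_mod_cast hn
  have h := abs_sub_round (m / n : ℚ)
  have h2 : |(m : ℚ) - n * round (m / n : ℚ)| = n * |(m / n : ℚ) - round (m / n : ℚ)| := by
    rw [← abs_of_pos hn', ← abs_mul, abs_of_pos hn', mul_sub, mul_div_cancel₀ _ hn'.ne']
  have : 2 * |(m : ℚ) - n * round (m / n : ℚ)| ≤ n := by rw [h2]; nlinarith
  exact_mod_cast this

lemma norm_sub_mul_quot_lt (x : EisensteinInt) {y : EisensteinInt} (hy : y ≠ 0) :
    (x - y * quot x y).norm < y.norm := by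
  have hn := norm_pos hy
  have h1 := two_mul_abs_sub_mul_round_le (x * star y).re hn
  have h2 := two_mul_abs_sub_mul_round_le (x * star y).im hn
  set p := (x * star y).re - y.norm * round ((x * star y).re / y.norm : ℚ) with hp
  set q := (x * star y).im - y.norm * round ((x * star y).im / y.norm : ℚ) with hq
  have key : (x - y * quot x y).norm * y.norm = p ^ 2 - p * q + q ^ 2 := by
    have h : (x - y * quot x y) * star y = ⟨p, q⟩ := by
      have : (x - y * quot x y) * star y
          = x * star y - algebraMap ℤ EisensteinInt y.norm * quot x y := by
        rw [algebraMap_norm_eq_mul_star]; ring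
      rw [this]
      ext <;> simp [hp, hq, quot]
    rw [← norm_star y, ← map_mul, h, norm_eq]
  have hp2 : 4 * p ^ 2 ≤ y.norm ^ 2 := by
    rw [← sq_abs p]; nlinarith [abs_nonneg p]
  have hq2 : 4 * q ^ 2 ≤ y.norm ^ 2 := by
    rw [← sq_abs q]; nlinarith [abs_nonneg q]
  refine lt_of_mul_lt_mul_right ?_ hn.le
  nlinarith [sq_nonneg (p + q)]

noncomputable instance : EuclideanDomain EisensteinInt where
  quotient := quot
  quotient_zero x := by ext <;> simp [quot]
  remainder x y := x - y * quot x y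
  quotient_mul_add_remainder_eq x y := by ring
  r x y := x.norm.natAbs < y.norm.natAbs
  r_wellFounded := (measure fun z : EisensteinInt => z.norm.natAbs).wf
  remainder_lt x y hy := by
    have := norm_sub_mul_quot_lt x hy
    have := norm_nonneg (x - y * quot x y)
    omega
  mul_left_not_lt x y hy := by
    rw [not_lt, map_mul, Int.natAbs_mul]
    refine Nat.le_mul_of_pos_right _ ?_
    have := norm_pos hy
    omega

lemma isCoprime_star {a b : ℤ} (hab : IsCoprime a b) (h3 : ¬ 3 ∣ a ^ 2 - a * b + b ^ 2) :
    IsCoprime (⟨a, b⟩ : EisensteinInt) (star ⟨a, b⟩) := by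
  obtain ⟨r, s, hrs⟩ := hab
  obtain ⟨u, v, huv⟩ := (Int.prime_three.coprime_iff_not_dvd).2 h3
  refine ⟨v • star (⟨a, b⟩ : EisensteinInt) +
    ⟨u, 0⟩ * (⟨r, 0⟩ * ⟨1, 2⟩ * ⟨-1, -1⟩ + ⟨s, 0⟩ * ⟨-1, -2⟩),
    ⟨u, 0⟩ * (⟨r, 0⟩ * ⟨-1, -2⟩ * ⟨0, 1⟩ + ⟨s, 0⟩ * ⟨1, 2⟩), ?_⟩
  ext
  · simp
    linear_combination huv + 3 * u * hrs
  · simp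
    ring

/-- The six units of the Eisenstein integers. -/
lemma eq_of_isUnit {z : EisensteinInt} (hz : IsUnit z) :
    ∃ e : ℤ, (e = 1 ∨ e = -1) ∧ (z = ⟨e, 0⟩ ∨ z = ⟨0, e⟩ ∨ z = ⟨e, e⟩) := by
  have h := isUnit_iff_norm_isUnit.1 hz
  have h1 : z.norm = 1 := by
    have := norm_nonneg z
    rcases Int.isUnit_iff.1 h with h | h <;> omega
  rw [norm_eq] at h1
  obtain ⟨x, y⟩ := z
  simp only at h1
  have hx : x ^ 2 ≤ 1 := by nlinarith [sq_nonneg (x - 2 * y)]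
  have hy : y ^ 2 ≤ 1 := by nlinarith [sq_nonneg (y - 2 * x)]
  have hx' : x = -1 ∨ x = 0 ∨ x = 1 := by
    have : -1 ≤ x := by nlinarith
    have : x ≤ 1 := by nlinarith
    omega
  have hy' : y = -1 ∨ y = 0 ∨ y = 1 := by
    have : -1 ≤ y := by nlinarith
    have : y ≤ 1 := by nlinarith
    omega
  rcases hx' with rfl | rfl | rfl <;> rcases hy' with rfl | rfl | rfl <;> simp_all

end EisensteinInt

/-- If `a ^ 2 - a b + b ^ 2` is a cube prime to `3`, and `a + b ω` is congruent modulo `3` to a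
rational integer, then `a + b ω` is itself a cube in the Eisenstein integers. -/
lemma exists_eisenstein_cube {a b h : ℤ} (hab : IsCoprime a b)
    (hh : a ^ 2 - a * b + b ^ 2 = h ^ 3) (hb : 3 ∣ b) :
    ∃ s t : ℤ, a = s ^ 3 - 3 * s * t ^ 2 + t ^ 3 ∧ b = 3 * s ^ 2 * t - 3 * s * t ^ 2 ∧
      h = s ^ 2 - s * t + t ^ 2 := by
  have ha : ¬ (3 : ℤ) ∣ a := fun ha => by
    simpa using Int.isUnit_iff.1 (hab.isUnit_of_dvd' ha hb)
  have h3 : ¬ (3 : ℤ) ∣ a ^ 2 - a * b + b ^ 2 := fun h => ha <| by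
    have : (3 : ℤ) ∣ a ^ 2 := by
      have := dvd_add h (hb.mul_right (a - b))
      ring_nf at this; exact this
    exact Int.prime_three.dvd_of_dvd_pow this
  have hmul : (⟨a, b⟩ : EisensteinInt) * star ⟨a, b⟩ = ⟨h, 0⟩ ^ 3 := by
    rw [← QuadraticAlgebra.algebraMap_norm_eq_mul_star, EisensteinInt.norm_eq]
    simp only [hh, map_pow]; rfl
  obtain ⟨⟨s, t⟩, w, hw⟩ :=
    exists_associated_pow_of_mul_eq_pow' (EisensteinInt.isCoprime_star hab h3) hmul
  suffices H : ∃ s t : ℤ, a = s ^ 3 - 3 * s * t ^ 2 + t ^ 3 ∧ b = 3 * s ^ 2 * t - 3 * s * t ^ 2 by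
    obtain ⟨s, t, h1, h2⟩ := H
    refine ⟨s, t, h1, h2, ?_⟩
    have : h ^ 3 = (s ^ 2 - s * t + t ^ 2) ^ 3 := by rw [← hh, h1, h2]; ring
    exact (Odd.strictMono_pow (by decide)).injective this
  have hcube : (⟨s, t⟩ : EisensteinInt) ^ 3
      = ⟨s ^ 3 - 3 * s * t ^ 2 + t ^ 3, 3 * (s ^ 2 * t - s * t ^ 2)⟩ := by
    ext <;> simp [pow_succ] <;> ring
  obtain ⟨e, he, hw' | hw' | hw'⟩ := EisensteinInt.eq_of_isUnit w.isUnit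
  · refine ⟨e * s, e * t, ?_⟩
    rw [hcube, hw'] at hw
    have h1 := congrArg QuadraticAlgebra.re hw
    have h2 := congrArg QuadraticAlgebra.im hw
    simp at h1 h2
    rcases he with rfl | rfl <;> constructor <;> linarith
  all_goals
    exfalso
    rw [hcube, hw'] at hw
    generalize s ^ 3 - 3 * s * t ^ 2 + t ^ 3 = p at hw
    generalize s ^ 2 * t - s * t ^ 2 = q at hw
    have h1 := congrArg QuadraticAlgebra.re hw
    have h2 := congrArg QuadraticAlgebra.im hw
    simp at h1 h2
    apply ha
    rcases he with rfl | rfl <;> omega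

namespace HesseCubic

lemma cube_injective : Function.Injective fun n : ℤ => n ^ 3 :=
  (Odd.strictMono_pow (by decide)).injective

/-- Three integers without common prime factor, whose sum is `4 v` and whose product is `v ^ 3`,
are cubes. -/
lemma exists_solution_of_prod_eq_cube {a b c v : ℤ} (hv : v ≠ 0)
    (hco : ∀ p : ℤ, Prime p → p ∣ a → p ∣ b → ¬ p ∣ c)
    (hsum : a + b + c = 4 * v) (hprod : a * b * c = v ^ 3) :
    ∃ x y z : ℤ, x ^ 3 + y ^ 3 + z ^ 3 = 4 * x * y * z ∧ x * y * z = v := by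
  have key : ∀ {a b c : ℤ}, (∀ p : ℤ, Prime p → p ∣ a → p ∣ b → ¬ p ∣ c) →
      a + b + c = 4 * v → a * b * c = v ^ 3 → ∃ x, a = x ^ 3 := by
    intro a b c hco hsum hprod
    have hdvd : ∀ p : ℤ, Prime p → p ∣ a → p ∣ v := fun p hp ha =>
      hp.dvd_of_dvd_pow (hprod ▸ (ha.mul_right b).mul_right c)
    have habc : IsCoprime a (b * c) := by
      refine isCoprime_of_prime_dvd ?_ fun p hp ha hbc => ?_
      · rintro ⟨rfl, -⟩
        exact hv (by simpa using hprod.symm)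
      · have h4 : p ∣ a + b + c := hsum ▸ (hdvd p hp ha).mul_left 4
        rcases hp.dvd_or_dvd hbc with hb | hc
        · exact hco p hp ha hb ((dvd_add_right (dvd_add ha hb)).1 h4)
        · refine hco p hp ha ?_ hc
          rw [add_right_comm] at h4
          exact (dvd_add_right (dvd_add ha hc)).1 h4
    exact Int.eq_pow_of_mul_eq_pow_odd_left habc (by decide) (by rw [← hprod]; ring)
  obtain ⟨x, rfl⟩ := key hco hsum hprod
  obtain ⟨y, rfl⟩ := key (a := b) (b := c) (c := x ^ 3) (fun p hp h1 h2 h3 => hco p hp h3 h1 h2)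
    (by linarith) (by linarith)
  obtain ⟨z, rfl⟩ := key (a := c) (b := x ^ 3) (c := y ^ 3) (fun p hp h1 h2 h3 => hco p hp h2 h3 h1)
    (by linarith) (by linarith)
  have hxyz : x * y * z = v := cube_injective (by simpa only [mul_pow] using hprod)
  exact ⟨x, y, z, by linarith, hxyz⟩

/-- As in `exists_solution_of_prod_eq_cube`, after dividing by the greatest common divisor. -/
lemma exists_solution_of_sum_prod {a b c u : ℤ} (hu : u ≠ 0)
    (hsum : a + b + c = 4 * u) (hprod : a * b * c = u ^ 3) :
    ∃ x y z : ℤ, x ^ 3 + y ^ 3 + z ^ 3 = 4 * x * y * z ∧ x * y * z ≠ 0 ∧ x * y * z ∣ u := by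
  have ha : a ≠ 0 := by
    rintro rfl
    exact hu (by simpa using hprod.symm)
  obtain ⟨g, hg⟩ : ∃ g, g = gcd a (gcd b c) := ⟨_, rfl⟩
  have hg0 : g ≠ 0 := by
    rw [hg]; exact fun h => ha (gcd_eq_zero_iff _ _ |>.1 h).1
  obtain ⟨a', ha'⟩ : g ∣ a := hg ▸ gcd_dvd_left _ _
  obtain ⟨b', hb'⟩ : g ∣ b := hg ▸ (gcd_dvd_right _ _).trans (gcd_dvd_left _ _)
  obtain ⟨c', hc'⟩ : g ∣ c := hg ▸ (gcd_dvd_right _ _).trans (gcd_dvd_right _ _)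
  have hprod' : g ^ 3 * (a' * b' * c') = u ^ 3 := by rw [← hprod, ha', hb', hc']; ring
  obtain ⟨v, rfl⟩ : g ∣ u := (Int.pow_dvd_pow_iff (by decide : 3 ≠ 0)).1 ⟨_, hprod'.symm⟩
  have hco : ∀ p : ℤ, Prime p → p ∣ a' → p ∣ b' → ¬ p ∣ c' := fun p hp h1 h2 h3 => by
    have hgp : g * p ∣ g := by
      conv_rhs => rw [hg]
      rw [ha', hb', hc']
      exact dvd_gcd (mul_dvd_mul_left _ h1) (dvd_gcd (mul_dvd_mul_left _ h2)
        (mul_dvd_mul_left _ h3))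
    exact hp.not_isUnit (isUnit_of_dvd_one ((mul_dvd_mul_iff_left hg0).1
      (hgp.trans (mul_one g).symm.dvd)))
  obtain ⟨x, y, z, hxyz, rfl⟩ := exists_solution_of_prod_eq_cube (right_ne_zero_of_mul hu) hco
    (mul_left_cancel₀ hg0 (by linear_combination hsum - ha' - hb' - hc'))
    (mul_left_cancel₀ (pow_ne_zero 3 hg0) (by linear_combination hprod'))
  exact ⟨x, y, z, hxyz, right_ne_zero_of_mul hu, dvd_mul_left _ _⟩

lemma exists_solution_of_twisted {u s t : ℤ} (hu : u ≠ 0)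
    (h : 12 * (u * (s ^ 2 - s * t + t ^ 2)) =
      37 * u ^ 3 + (2 * s - t) * (-s - t) * (-s + 2 * t)) :
    ∃ x y z : ℤ, x ^ 3 + y ^ 3 + z ^ 3 = 4 * x * y * z ∧ x * y * z ≠ 0 ∧ x * y * z ∣ u := by
  have hprod : (2 * s - t + 4 * u) * (-s - t + 4 * u) * (-s + 2 * t + 4 * u) = 27 * u ^ 3 := by
    linear_combination -h
  obtain ⟨k, hk⟩ : (3 : ℤ) ∣ -s - t + 4 * u := by
    have h3 : (3 : ℤ) ∣ (2 * s - t + 4 * u) * (-s - t + 4 * u) * (-s + 2 * t + 4 * u) :=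
      hprod ▸ ⟨9 * u ^ 3, by ring⟩
    rcases Int.prime_three.dvd_or_dvd h3 with h3 | h3
    · rcases Int.prime_three.dvd_or_dvd h3 with h3 | h3 <;> omega
    · omega
  refine exists_solution_of_sum_prod (a := k + s) (b := k) (c := k + t) hu (by linarith) ?_
  refine mul_left_cancel₀ (by norm_num : (27 : ℤ) ≠ 0) ?_
  rw [← hprod, show 2 * s - t + 4 * u = 3 * (k + s) by linarith, hk,
    show -s + 2 * t + 4 * u = 3 * (k + t) by linarith]
  ring

/-- Descent step for solutions lying on the component `4 x + 3 y + 3 z = 0` of the reduction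
modulo `37`, when `3` does not divide `x`. -/
lemma exists_twisted_of_not_three_dvd {x y z w : ℤ} (hxy : IsCoprime x y) (hxz : IsCoprime x z)
    (hx : ¬ 3 ∣ x) (hx0 : x ≠ 0) (hw : 4 * x + 3 * y + 3 * z = 37 * w)
    (h : x ^ 3 + y ^ 3 + z ^ 3 = 4 * x * y * z) :
    ∃ u s t : ℤ, x = u * (s ^ 2 - s * t + t ^ 2) ∧ 12 * (u * (s ^ 2 - s * t + t ^ 2)) =
      37 * u ^ 3 + (2 * s - t) * (-s - t) * (-s + 2 * t) := by
  obtain ⟨a, ha⟩ : ∃ a, a = 4 * x - 3 * y := ⟨_, rfl⟩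
  obtain ⟨b, hb⟩ : ∃ b, b = 3 * (z - y) := ⟨_, rfl⟩
  have hmul : w * (a ^ 2 - a * b + b ^ 2) = x ^ 3 := by
    refine mul_left_cancel₀ (by norm_num : (37 : ℤ) ≠ 0) ?_
    rw [← mul_assoc, ← hw, ha, hb]
    linear_combination 27 * h
  have h3 : ∀ p : ℤ, Prime p → p ∣ x → ¬ p ∣ 3 := fun p hp hpx hp3 =>
    hx <| (((Int.prime_three.irreducible.dvd_iff).1 hp3).resolve_left hp.not_isUnit).dvd.trans hpx
  have hco : IsCoprime w (a ^ 2 - a * b + b ^ 2) := by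
    refine isCoprime_of_prime_dvd (fun h => hx0 (by simpa [h.1] using hmul.symm)) ?_
    intro p hp hpw hpq
    have hpx : p ∣ x := hp.dvd_of_dvd_pow (hmul ▸ hpw.mul_right _)
    have hyz' : p ∣ y + z := by
      refine (hp.dvd_or_dvd (b := y + z) (a := 3) ?_).resolve_left (h3 p hp hpx)
      rw [show 3 * (y + z) = 37 * w - 4 * x by linarith]
      exact dvd_sub (hpw.mul_left _) (hpx.mul_left _)
    have h27 : p ∣ 3 * (3 * (3 * (y * z))) := by
      rw [show 3 * (3 * (3 * (y * z))) = 9 * (y + z) * (y + z) + x * (16 * x - 12 * y - 12 * z)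
        - (a ^ 2 - a * b + b ^ 2) by rw [ha, hb]; ring]
      exact dvd_sub (dvd_add (hyz'.mul_left _) (hpx.mul_right _)) hpq
    have hpyz := (hp.dvd_or_dvd ((hp.dvd_or_dvd ((hp.dvd_or_dvd h27).resolve_left
      (h3 p hp hpx))).resolve_left (h3 p hp hpx))).resolve_left (h3 p hp hpx)
    exact hp.not_isUnit ((hxy.mul_right hxz).isUnit_of_dvd' hpx hpyz)
  obtain ⟨⟨u, hu⟩, k, hk⟩ := Int.eq_pow_of_mul_eq_pow_odd hco (by decide) hmul
  have hab : IsCoprime a b := by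
    refine isCoprime_of_prime_dvd (fun h => hx0 (by simpa [h.1, h.2] using hmul.symm)) ?_
    intro p hp hpa hpb
    have hpx : p ∣ x := hp.dvd_of_dvd_pow <| hmul ▸ Dvd.dvd.mul_left
      (dvd_add (dvd_sub (dvd_pow hpa (by decide)) (hpa.mul_right _)) (dvd_pow hpb (by decide))) _
    have hpy : p ∣ y := by
      refine (hp.dvd_or_dvd (a := 3) ?_).resolve_left (h3 p hp hpx)
      rw [show 3 * y = 4 * x - a by rw [ha]; ring]
      exact dvd_sub (hpx.mul_left _) hpa
    exact hp.not_isUnit (hxy.isUnit_of_dvd' hpx hpy)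
  obtain ⟨s, t, has, hbs, hks⟩ := exists_eisenstein_cube hab hk ⟨_, hb⟩
  have hxu : x = u * (s ^ 2 - s * t + t ^ 2) :=
    cube_injective (by simp only [← hmul, hk, hu, hks]; ring)
  refine ⟨u, s, t, hxu, ?_⟩
  rw [← hxu]
  have : 12 * x = 37 * w + 2 * a - b := by rw [ha, hb]; linarith
  rw [this, has, hbs, hu]
  ring

/-- Descent step for solutions lying on the component `4 x + 3 y + 3 z = 0` of the reduction
modulo `37`, when `3` divides `x`. -/
lemma exists_twisted_of_three_dvd {x y z w : ℤ} (hxy : IsCoprime x y) (hxz : IsCoprime x z)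
    (hx : 3 ∣ x) (hx0 : x ≠ 0) (hw : 4 * x + 3 * y + 3 * z = 37 * w)
    (h : x ^ 3 + y ^ 3 + z ^ 3 = 4 * x * y * z) :
    ∃ u s t : ℤ, x = u * (s ^ 2 - s * t + t ^ 2) ∧ 12 * (u * (s ^ 2 - s * t + t ^ 2)) =
      37 * u ^ 3 + (2 * s - t) * (-s - t) * (-s + 2 * t) := by
  have hp3 := Int.prime_three
  have hy3 : ¬ (3 : ℤ) ∣ y := fun hy => hp3.not_isUnit (hxy.isUnit_of_dvd' hx hy)
  have hz3 : ¬ (3 : ℤ) ∣ z := fun hz => hp3.not_isUnit (hxz.isUnit_of_dvd' hx hz)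
  have hyz3 : ¬ (3 : ℤ) ∣ y * z := hp3.not_dvd_mul hy3 hz3
  obtain ⟨x₀, rfl⟩ := hx
  obtain ⟨k, hk⟩ : (3 : ℤ) ∣ y + z := by
    refine hp3.dvd_of_dvd_pow (n := 3) ⟨4 * x₀ * y * z - 9 * x₀ ^ 3 + y * z * (y + z), ?_⟩
    linear_combination h
  obtain rfl : z = 3 * k - y := by linarith
  obtain ⟨x₁, rfl⟩ : (3 : ℤ) ∣ x₀ := by
    refine (hp3.dvd_or_dvd (b := y * (3 * k - y)) ⟨3 * x₀ ^ 3 + 3 * k ^ 3 - x₀ * y * (3 * k - y)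
      - k * y * (3 * k - y), ?_⟩).resolve_right hyz3
    refine mul_left_cancel₀ (by norm_num : (3 : ℤ) ≠ 0) ?_
    linear_combination -h
  have hk1 : (3 : ℤ) ∣ k + x₁ := by
    refine (hp3.dvd_or_dvd (b := y * (3 * k - y)) ⟨27 * x₁ ^ 3 + k ^ 3 - x₁ * y * (3 * k - y), ?_⟩)
      |>.resolve_right hyz3
    refine mul_left_cancel₀ (by norm_num : (9 : ℤ) ≠ 0) ?_
    linear_combination -h
  have hx1 : x₁ ≠ 0 := by rintro rfl; simp at hx0
  obtain ⟨a, ha⟩ : ∃ a, a = 4 * x₁ - 2 * k + y := ⟨_, rfl⟩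
  obtain ⟨b, hb⟩ : ∃ b, b = 8 * x₁ - k := ⟨_, rfl⟩
  have hb3 : (3 : ℤ) ∣ b := by omega
  have hN3 : ¬ (3 : ℤ) ∣ a ^ 2 - a * b + b ^ 2 := fun hN => by
    have : (3 : ℤ) ∣ a ^ 2 := by
      have := dvd_add hN (hb3.mul_right (a - b))
      ring_nf at this; exact this
    have := hp3.dvd_of_dvd_pow this
    omega
  have hmul' : w * (a ^ 2 - a * b + b ^ 2) = 27 * x₁ ^ 3 := by
    refine mul_left_cancel₀ (by norm_num : (37 * 27 : ℤ) ≠ 0) ?_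
    rw [show 37 * 27 * (w * (a ^ 2 - a * b + b ^ 2))
      = 37 * w * (27 * (a ^ 2 - a * b + b ^ 2)) by ring, ← hw, ha, hb]
    linear_combination 27 * h
  obtain ⟨v, rfl⟩ : (27 : ℤ) ∣ w := by
    have : IsCoprime (3 ^ 3 : ℤ) (a ^ 2 - a * b + b ^ 2) :=
      ((hp3.coprime_iff_not_dvd).2 hN3).pow_left
    exact this.dvd_of_dvd_mul_right ⟨_, hmul'⟩
  have hmul : v * (a ^ 2 - a * b + b ^ 2) = x₁ ^ 3 := by linarith
  have hbad : ∀ p : ℤ, Prime p → p ∣ x₁ → p ∣ k → ¬ p ∣ a := fun p hp hpx hpk hpa => by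
    refine hp.not_isUnit (hxy.isUnit_of_dvd' ((hpx.mul_left 3).mul_left 3) ?_)
    rw [show y = a - 4 * x₁ + 2 * k by rw [ha]; ring]
    exact dvd_add (dvd_sub hpa (hpx.mul_left _)) (hpk.mul_left _)
  have hco : IsCoprime v (a ^ 2 - a * b + b ^ 2) := by
    refine isCoprime_of_prime_dvd (fun h => hx1 (by simpa [h.1] using hmul.symm)) ?_
    intro p hp hpv hpq
    have hpx : p ∣ x₁ := hp.dvd_of_dvd_pow (hmul ▸ hpv.mul_right _)
    have hpk : p ∣ k := by
      rw [show k = 111 * v - 4 * x₁ by linarith]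
      exact dvd_sub (hpv.mul_left _) (hpx.mul_left _)
    have hpb : p ∣ b := hb ▸ dvd_sub (hpx.mul_left _) hpk
    refine hbad p hp hpx hpk (hp.dvd_of_dvd_pow (n := 2) ?_)
    rw [show a ^ 2 = (a ^ 2 - a * b + b ^ 2) + b * (a - b) by ring]
    exact dvd_add hpq (hpb.mul_right _)
  obtain ⟨⟨u, hu⟩, n, hn⟩ := Int.eq_pow_of_mul_eq_pow_odd hco (by decide) hmul
  have hab : IsCoprime a b := by
    refine isCoprime_of_prime_dvd (fun h => hx1 (by simpa [h.1, h.2] using hmul.symm)) ?_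
    intro p hp hpa hpb
    have hpx : p ∣ x₁ := hp.dvd_of_dvd_pow <| hmul ▸ Dvd.dvd.mul_left
      (dvd_add (dvd_sub (dvd_pow hpa (by decide)) (hpa.mul_right _)) (dvd_pow hpb (by decide))) _
    refine hbad p hp hpx ?_ hpa
    rw [show k = 8 * x₁ - b by rw [hb]; ring]
    exact dvd_sub (hpx.mul_left _) hpb
  obtain ⟨s, t, -, hbs, hns⟩ := exists_eisenstein_cube hab hn hb3
  have hxu : x₁ = u * (s ^ 2 - s * t + t ^ 2) :=
    cube_injective (by simp only [← hmul, hn, hu, hns]; ring)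
  refine ⟨3 * u, s + t, 2 * t - s, by rw [hxu]; ring, ?_⟩
  linear_combination -108 * hxu + hw + 999 * hu + 9 * hbs - 9 * hb

lemma exists_solution_of_dvd {x y z : ℤ} (hxy : IsCoprime x y) (hxz : IsCoprime x z) (hx0 : x ≠ 0)
    (hw : 37 ∣ 4 * x + 3 * y + 3 * z) (h : x ^ 3 + y ^ 3 + z ^ 3 = 4 * x * y * z) :
    ∃ x' y' z' : ℤ, x' ^ 3 + y' ^ 3 + z' ^ 3 = 4 * x' * y' * z' ∧ x' * y' * z' ≠ 0 ∧
      x' * y' * z' ∣ x := by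
  obtain ⟨w, hw⟩ := hw
  obtain ⟨u, s, t, hxu, hust⟩ : ∃ u s t : ℤ, x = u * (s ^ 2 - s * t + t ^ 2) ∧
      12 * (u * (s ^ 2 - s * t + t ^ 2)) =
        37 * u ^ 3 + (2 * s - t) * (-s - t) * (-s + 2 * t) := by
    by_cases hx : 3 ∣ x
    · exact exists_twisted_of_three_dvd hxy hxz hx hx0 hw h
    · exact exists_twisted_of_not_three_dvd hxy hxz hx hx0 hw h
  obtain ⟨x', y', z', h', h0, hdvd⟩ :=
    exists_solution_of_twisted (left_ne_zero_of_mul (hxu ▸ hx0)) hust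
  exact ⟨x', y', z', h', h0, hdvd.trans ⟨_, hxu⟩⟩

lemma one_lt_natAbs_mul {x y z : ℤ} (hx0 : x ≠ 0) (hy0 : y ≠ 0) (hz0 : z ≠ 0)
    (h : x ^ 3 + y ^ 3 + z ^ 3 = 4 * x * y * z) : 1 < (y * z).natAbs := by
  by_contra! hle
  have hpos : 0 < (y * z).natAbs := Int.natAbs_pos.2 (mul_ne_zero hy0 hz0)
  have hyz : IsUnit (y * z) := Int.isUnit_iff_natAbs_eq.2 (by omega)
  have hy := Int.isUnit_iff.1 (isUnit_of_mul_isUnit_left hyz)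
  have hz := Int.isUnit_iff.1 (isUnit_of_mul_isUnit_right hyz)
  have hfac : x * (x ^ 2 - 4 * y * z) = -(y ^ 3 + z ^ 3) := by linear_combination h
  have hdvd : x ∣ 2 := by
    rcases hy with rfl | rfl <;> rcases hz with rfl | rfl <;> norm_num at hfac
    · exact ⟨-(x ^ 2 - 4), by linarith⟩
    · rcases hfac with hfac | hfac
      · exact absurd hfac hx0
      · nlinarith [sq_nonneg x]
    · rcases hfac with hfac | hfac
      · exact absurd hfac hx0
      · nlinarith [sq_nonneg x]
    · exact ⟨x ^ 2 - 4, by linarith⟩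
  have h1 := Int.le_of_dvd (by norm_num) hdvd
  have h2 := Int.le_of_dvd (by norm_num) ((neg_dvd).2 hdvd)
  have h3 : -2 ≤ x := by linarith
  rcases hy with rfl | rfl <;> rcases hz with rfl | rfl <;> interval_cases x <;> omega

theorem mul_eq_zero_of_int {x y z : ℤ} (h : x ^ 3 + y ^ 3 + z ^ 3 = 4 * x * y * z) :
    x * y * z = 0 := by
  induction hn : (x * y * z).natAbs using Nat.strong_induction_on generalizing x y z with
  | _ n ih =>
  by_contra h0
  have hcop : ∀ {x y z : ℤ}, x ^ 3 + y ^ 3 + z ^ 3 = 4 * x * y * z → (x * y * z).natAbs = n →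
      x * y * z ≠ 0 → IsCoprime x y := by
    intro x y z h hn h0
    refine isCoprime_of_prime_dvd (fun h => h0 (by simp [h.1])) fun p hp hpx hpy => ?_
    obtain ⟨z, rfl⟩ : p ∣ z := by
      refine hp.dvd_of_dvd_pow (n := 3) ?_
      rw [show z ^ 3 = x * (4 * y * z) - x * x ^ 2 - y * y ^ 2 by linear_combination h]
      exact dvd_sub (dvd_sub (hpx.mul_right _) (hpx.mul_right _)) (hpy.mul_right _)
    obtain ⟨x, rfl⟩ := hpx
    obtain ⟨y, rfl⟩ := hpy
    have hfac : p * x * (p * y) * (p * z) = p ^ 3 * (x * y * z) := by ring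
    rw [hfac] at h0 hn
    refine right_ne_zero_of_mul h0 (ih _ ?_ ?_ rfl)
    · have : 0 < (x * y * z).natAbs := Int.natAbs_pos.2 (right_ne_zero_of_mul h0)
      rw [← hn, Int.natAbs_mul (p ^ 3), Int.natAbs_pow]
      exact lt_mul_of_one_lt_left this
        (Nat.one_lt_pow (by decide) (Int.prime_iff_natAbs_prime.1 hp).one_lt)
    · exact mul_left_cancel₀ (pow_ne_zero 3 hp.ne_zero) (by linear_combination h)
  have hstep : ∀ {x y z : ℤ}, x ^ 3 + y ^ 3 + z ^ 3 = 4 * x * y * z → (x * y * z).natAbs = n →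
      x * y * z ≠ 0 → ¬ 37 ∣ 4 * x + 3 * y + 3 * z := by
    intro x y z h hn h0 hw
    have hx0 := left_ne_zero_of_mul (left_ne_zero_of_mul h0)
    have hy0 := right_ne_zero_of_mul (left_ne_zero_of_mul h0)
    have hz0 := right_ne_zero_of_mul h0
    have hxz : IsCoprime x z := hcop (z := y) (by linarith) (by rw [← hn]; ring_nf)
      (by rwa [mul_right_comm])
    obtain ⟨x', y', z', h', h0', hdvd⟩ := exists_solution_of_dvd (hcop h hn h0) hxz hx0 hw h
    refine h0' (ih _ ?_ h' rfl)
    have hle := Nat.le_of_dvd (Int.natAbs_pos.2 hx0) (Int.natAbs_dvd_natAbs.2 hdvd)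
    rw [← hn, mul_assoc x, Int.natAbs_mul x]
    exact hle.trans_lt
      (lt_mul_of_one_lt_right (Int.natAbs_pos.2 hx0) (one_lt_natAbs_mul hx0 hy0 hz0 h))
  have h37 : (37 : ℤ) ∣ (4 * x + 3 * y + 3 * z) * ((4 * y + 3 * z + 3 * x) *
      (4 * z + 3 * x + 3 * y)) := by
    refine ⟨3 * (x ^ 2 * y + x ^ 2 * z + y ^ 2 * x + y ^ 2 * z + z ^ 2 * x + z ^ 2 * y)
      + 10 * (x * y * z), ?_⟩
    linear_combination 36 * h
  have hp37 : Prime (37 : ℤ) := Int.prime_iff_natAbs_prime.2 (by norm_num)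
  rcases hp37.dvd_or_dvd h37 with h1 | h1
  · exact hstep h hn h0 h1
  rcases hp37.dvd_or_dvd h1 with h1 | h1
  · exact hstep (by linarith) (by rw [← hn]; ring_nf) (by convert h0 using 1; ring) h1
  · exact hstep (by linarith) (by rw [← hn]; ring_nf) (by convert h0 using 1; ring) h1

theorem mul_eq_zero_of_rat {x y z : ℚ} (h : x ^ 3 + y ^ 3 + z ^ 3 = 4 * x * y * z) :
    x * y * z = 0 := by
  have hxd : (x.den : ℚ) ≠ 0 := by exact_mod_cast x.den_nz
  have hyd : (y.den : ℚ) ≠ 0 := by exact_mod_cast y.den_nz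
  have hzd : (z.den : ℚ) ≠ 0 := by exact_mod_cast z.den_nz
  have key : ((x.num * y.den * z.den : ℤ) : ℚ) = x * (x.den * y.den * z.den) ∧
      ((y.num * x.den * z.den : ℤ) : ℚ) = y * (x.den * y.den * z.den) ∧
      ((z.num * x.den * y.den : ℤ) : ℚ) = z * (x.den * y.den * z.den) := by
    push_cast
    rw [← Rat.mul_den_eq_num x, ← Rat.mul_den_eq_num y, ← Rat.mul_den_eq_num z]
    refine ⟨?_, ?_, ?_⟩ <;> ring
  obtain ⟨h1, h2, h3⟩ := key
  have hprod := mul_eq_zero_of_int (x := x.num * y.den * z.den) (y := y.num * x.den * z.den)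
    (z := z.num * x.den * y.den) (by
      rw [← Int.cast_inj (α := ℚ), Int.cast_add, Int.cast_add, Int.cast_mul, Int.cast_mul,
        Int.cast_mul, Int.cast_pow, Int.cast_pow, Int.cast_pow, h1, h2, h3]
      push_cast
      linear_combination (x.den * y.den * z.den : ℚ) ^ 3 * h)
  rw [← Int.cast_inj (α := ℚ), Int.cast_mul, Int.cast_mul, h1, h2, h3] at hprod
  have hd : (x.den * y.den * z.den : ℚ) ≠ 0 := by positivity
  simpa [hd, hxd, hyd, hzd] using hprod

end HesseCubic

lemma E₀_nonsingular_iff (x y : ℚ) :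
    E₀.toAffine.Nonsingular x y ↔ x = 8 ∧ (y = 18 ∨ y = -19) := by
  rw [WeierstrassCurve.Affine.nonsingular_iff, WeierstrassCurve.Affine.equation_iff]
  simp only [E₀, WeierstrassCurve.toAffine]
  constructor
  · rintro ⟨h, -⟩
    have hx : x = 8 := by
      have h0 := HesseCubic.mul_eq_zero_of_rat (x := 3 * x + 13) (y := y - 2 * x - 2)
        (z := -y - 2 * x - 3) (by linear_combination 37 * h)
      have key : ∀ {a b : ℚ}, a ^ 3 + b ^ 3 = 0 → a + b = 0 := by
        intro a b hab
        have := (Odd.strictMono_pow (by decide : Odd 3)).injective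
          (show a ^ 3 = (-b) ^ 3 by linear_combination hab)
        linarith
      rcases mul_eq_zero.1 h0 with h0 | h0
      · rcases mul_eq_zero.1 h0 with h0 | h0
        · have := key (a := y - 2 * x - 2) (b := -y - 2 * x - 3) (by
            linear_combination 37 * h -
              ((3 * x + 13) ^ 2 - 4 * (y - 2 * x - 2) * (-y - 2 * x - 3)) * h0)
          linarith
        · have := key (a := 3 * x + 13) (b := -y - 2 * x - 3) (by
            linear_combination 37 * h -
              ((y - 2 * x - 2) ^ 2 - 4 * (3 * x + 13) * (-y - 2 * x - 3)) * h0)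
          linarith
      · have := key (a := 3 * x + 13) (b := y - 2 * x - 2) (by
          linear_combination 37 * h -
            ((-y - 2 * x - 3) ^ 2 - 4 * (y - 2 * x - 2) * (3 * x + 13)) * h0)
        linarith
    subst hx
    refine ⟨rfl, ?_⟩
    have : (y - 18) * (y + 19) = 0 := by linear_combination h
    rcases mul_eq_zero.1 this with h | h
    · exact .inl (by linarith)
    · exact .inr (by linarith)
  · rintro ⟨rfl, rfl | rfl⟩ <;> norm_num

/-- The Mordell–Weil group of the elliptic curve `37.b2 : y² + y = x³ + x² - 23x - 50` over `ℚ`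
is isomorphic to `ℤ/3ℤ`; in particular it is finite of order `3`. -/
theorem mordell_weil_37b2 : Nonempty (E₀.toAffine.Point ≃+ ZMod 3) := by
  have : Fact (Nat.Prime 3) := ⟨Nat.prime_three⟩
  have hcard : Nat.card E₀.toAffine.Point = 3 := by
    have h1 : E₀.toAffine.Nonsingular 8 18 := (E₀_nonsingular_iff _ _).2 ⟨rfl, .inl rfl⟩
    have h2 : E₀.toAffine.Nonsingular 8 (-19) := (E₀_nonsingular_iff _ _).2 ⟨rfl, .inr rfl⟩
    have huniv : (Set.univ : Set E₀.toAffine.Point) = {.zero, .some _ _ h1, .some _ _ h2} := by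
      ext P
      simp only [Set.mem_univ, Set.mem_insert_iff, Set.mem_singleton_iff, true_iff]
      rcases P with _ | ⟨x, y, h⟩
      · exact .inl rfl
      · obtain ⟨rfl, rfl | rfl⟩ := (E₀_nonsingular_iff x y).1 h
        · exact .inr (.inl rfl)
        · exact .inr (.inr rfl)
    rw [← Set.ncard_univ, huniv, Set.ncard_eq_three]
    exact ⟨_, _, _, by simp, by simp, by norm_num, rfl⟩
  exact ⟨addEquivOfPrimeCardEq hcard (Nat.card_zmod 3)⟩
end
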